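/- (Oracle bound on the statistical risk of gradient descent for shallow networks.) Let $d\ge 0$ and $m,n,T\ge 1$ be integers and let $\phi:\mathbb R\to\mathbb R$ be twice differentiable with $|\phi|\le B_\phi$, $|\phi'|\le B_{\phi'}$, $|\phi''|\le B_{\phi''}$. Fix $u\in\{\pm 1/\sqrt m\}^m$ and, for $W=(W_1,\dots,W_m)\in\mathbb R^{d\times m}$, put $f_W(x)=\sum_{k=1}^m u_k\,\phi(\langle W_k,x\rangle)$ and $\ell(W,(x,y))=\tfrac12(f_W(x)-y)^2$. Let $C_x,C_y,C_0>0$, let $P$ be a probability distribution supported on $\{x\in\mathbb R^d:\|x\|_2\le C_x\}\times[-C_y,C_y]$, let $S=(z_1,\dots,z_n)$ be i.i.d. from $P$, and write $L_S(W)=\frac1n\sum_{i=1}^n\ell(W,z_i)$, $L(W)=\mathbf E_{z\sim P}\,\ell(W,z)$. Fix $W_0\in\mathbb R^{d\times m}$ with $\ell(W_0,z)\le C_0$ for $P$-almost every $z$, and let $W_{s+1}=W_s-\eta\nabla L_S(W_s)$ with $\eta>0$. Set $\rho=C_x^2\big(B_{\phi'}^2+B_{\phi''}B_\phi+B_{\phi''}C_y/\sqrt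 m\big)$. Suppose that $\eta\le 1/(2\rho)$ (no restriction if $\rho=0$) and $$m\ \ge\ 144\,(\eta T)^2\,C_x^4\,C_0^2\,B_{\phi''}^2\,\big(4B_{\phi'}C_x\sqrt{\eta T}+\sqrt2\big)^2 .$$ Then $$\mathbf E[L(W_T)]\le\Big(1+b\,\frac{\eta T}{n}\Big(1+\frac{\eta T}{n}\Big)\Big)\,\mathbf E\Big[\min_{W\in\mathbb R^{d\times m}}\Big\{L_S(W)+\frac{\|W-W_0\|_F^2}{\eta T}+\frac{2^{3/2}\,\tilde b}{\sqrt m}\Big(\|W-W_0\|_F^3+(\eta T C_0)^{3/2}\Big)\Big\}\Big],$$ where $b=16e^3C_x^{2}B_{\phi'}^2\big(1+C_x^{2}B_{\phi'}^2\big)$, $\tilde b=C_x^2B_{\phi''}(B_{\phi'}C_x+C_0)$, and the expectations are over the sample $S$. -/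

import Mathlib

open MeasureTheory

noncomputable section

/-- The parameter space `ℝ^{d×m}` of a width-`m` shallow network on `ℝ^d`; the Euclidean norm
is the Frobenius norm, and `W (k, j)` is the `j`-th coordinate of the `k`-th neuron `W_k`. -/
abbrev Param (d m : ℕ) : Type := EuclideanSpace ℝ (Fin m × Fin d)

/-- Inputs live in `ℝ^d` with the Euclidean norm. -/
abbrev Input (d : ℕ) : Type := EuclideanSpace ℝ (Fin d)

/-- Shallow network `f_W(x) = ∑ₖ uₖ φ(⟨Wₖ, x⟩)`. -/
def nnet {d m : ℕ} (φ : ℝ → ℝ) (u : Fin m → ℝ) (W : Param d m) (x : Input d) : ℝ :=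
  ∑ k : Fin m, u k * φ (∑ j : Fin d, W (k, j) * x j)

/-- Squared loss `ℓ(W, (x, y)) = (f_W(x) − y)² / 2`. -/
def sqLoss {d m : ℕ} (φ : ℝ → ℝ) (u : Fin m → ℝ) (W : Param d m) (z : Input d × ℝ) : ℝ :=
  (nnet φ u W z.1 - z.2) ^ 2 / 2

/-- Empirical risk `L_S(W) = (1/n) ∑ᵢ ℓ(W, zᵢ)`. -/
def empRisk {d m n : ℕ} (φ : ℝ → ℝ) (u : Fin m → ℝ) (S : Fin n → Input d × ℝ)
    (W : Param d m) : ℝ :=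
  (∑ i : Fin n, sqLoss φ u W (S i)) / n

/-- Population risk `L(W) = E_{z ∼ μ} ℓ(W, z)`. -/
def popRisk {d m : ℕ} (φ : ℝ → ℝ) (u : Fin m → ℝ) (μ : Measure (Input d × ℝ))
    (W : Param d m) : ℝ :=
  ∫ z, sqLoss φ u W z ∂μ

/-- Gradient-descent iterates `W_{t+1} = W_t − η ∇L(W_t)` started at `W0`. -/
def gdIter {d m : ℕ} (η : ℝ) (L : Param d m → ℝ) (W0 : Param d m) : ℕ → Param d m
  | 0 => W0
  | t + 1 => gdIter η L W0 t - η • gradient L (gdIter η L W0 t)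

/-- The smoothness constant `ρ = C_x² (B_{φ'}² + B_{φ''} B_φ + B_{φ''} C_y / √m)`. -/
def smoothConst (m : ℕ) (Bφ Bφ' Bφ'' Cx Cy : ℝ) : ℝ :=
  Cx ^ 2 * (Bφ' ^ 2 + Bφ'' * Bφ + Bφ'' * Cy / Real.sqrt m)

/-- `b = 16 e³ C_x² B_{φ'}² (1 + C_x² B_{φ'}²)`. -/
def genConst (Bφ' Cx : ℝ) : ℝ :=
  16 * Real.exp 3 * (Cx ^ 2 * Bφ' ^ 2) * (1 + Cx ^ 2 * Bφ' ^ 2)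

/-- `b̃ = C_x² B_{φ''} (B_{φ'} C_x + C_0)`. -/
def optConst (Bφ' Bφ'' Cx C0 : ℝ) : ℝ :=
  Cx ^ 2 * Bφ'' * (Bφ' * Cx + C0)

end

/-- A differentiable residual `h` with gradient `g`, where `h` is `G`-Lipschitz, `g` is
`κ`-Lipschitz, and `ρ` bounds the curvature of `h ^ 2 / 2`. -/
structure SmoothResidual {E : Type*} [NormedAddCommGroup E] [InnerProductSpace ℝ E]
    (G κ ρ : ℝ) (h : E → ℝ) (g : E → E) : Prop where
  norm_grad_le : ∀ W, ‖g W‖ ≤ G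
  norm_grad_sub_le : ∀ W V, ‖g W - g V‖ ≤ κ * ‖W - V‖
  abs_taylor_le : ∀ W V, |h V - h W - inner ℝ (g W) (V - W)| ≤ κ / 2 * ‖V - W‖ ^ 2
  abs_sub_le : ∀ W V, |h V - h W| ≤ G * ‖V - W‖
  curvature_le : ∀ W, |h W| * κ + G ^ 2 ≤ ρ

/-- Second-order Taylor bound for a function whose second derivative is bounded. -/
theorem abs_taylor_one_le {φ : ℝ → ℝ} {B : ℝ} (hφ : Differentiable ℝ φ)
    (hφ' : Differentiable ℝ (deriv φ)) (hB : ∀ s, |deriv (deriv φ) s| ≤ B) (a b : ℝ) :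
    |φ b - φ a - deriv φ a * (b - a)| ≤ B / 2 * (b - a) ^ 2 := by
  have hlip : ∀ x y, |deriv φ x - deriv φ y| ≤ B * |x - y| := fun x y =>
    Convex.norm_image_sub_le_of_norm_deriv_le (f := deriv φ) (s := Set.univ)
      (fun x _ => hφ' x) (fun x _ => hB x) convex_univ (Set.mem_univ y) (Set.mem_univ x)
  have hd : ∀ t, HasDerivAt (fun t : ℝ => φ (a + t * (b - a)) - φ a - deriv φ a * (t * (b - a)))
      ((deriv φ (a + t * (b - a)) - deriv φ a) * (b - a)) t := by
    intro t
    have h1 : HasDerivAt (fun t : ℝ => t * (b - a)) (b - a) t := by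
      simpa using (hasDerivAt_id t).mul_const (b - a)
    have h2 : HasDerivAt (fun t : ℝ => φ (a + t * (b - a)))
        (deriv φ (a + t * (b - a)) * (b - a)) t :=
      (hφ (a + t * (b - a))).hasDerivAt.comp t (h1.const_add a)
    have h3 := (h2.sub_const (φ a)).sub (h1.const_mul (deriv φ a))
    rw [sub_mul]
    exact h3
  have hmain := image_norm_le_of_norm_deriv_right_le_deriv_boundary (a := 0) (b := 1)
    (f := fun t : ℝ => φ (a + t * (b - a)) - φ a - deriv φ a * (t * (b - a)))
    (f' := fun t => (deriv φ (a + t * (b - a)) - deriv φ a) * (b - a))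
    (B := fun t => B / 2 * (b - a) ^ 2 * t ^ 2) (B' := fun t => B * (b - a) ^ 2 * t)
    (fun t _ => (hd t).continuousAt.continuousWithinAt)
    (fun t _ => (hd t).hasDerivWithinAt) (by simp)
    (fun t => by
      have := (hasDerivAt_pow 2 t).const_mul (B / 2 * (b - a) ^ 2)
      refine this.congr_deriv ?_
      push_cast; ring)
    (fun t ht => by
      rw [Real.norm_eq_abs, abs_mul]
      have h1 := hlip (a + t * (b - a)) a
      rw [add_sub_cancel_left, abs_mul, abs_of_nonneg ht.1] at h1
      calc _ ≤ B * (t * |b - a|) * |b - a| := by gcongr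
        _ = B * |b - a| ^ 2 * t := by ring
        _ = _ := by rw [sq_abs])
    (Set.right_mem_Icc.2 zero_le_one)
  simpa using hmain

/-- The gradient of `W ↦ f_W(x)`. -/
noncomputable def netGrad {d m : ℕ} (φ : ℝ → ℝ) (u : Fin m → ℝ) (W : Param d m) (x : Input d) :
    Param d m :=
  WithLp.toLp 2 fun p => u p.1 * deriv φ (∑ j : Fin d, W (p.1, j) * x j) * x p.2

section Network

variable {d m : ℕ} {φ : ℝ → ℝ} {u : Fin m → ℝ}

theorem sum_preactivation_sq_le (D : Param d m) (x : Input d) :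
    ∑ k : Fin m, (∑ j : Fin d, D (k, j) * x j) ^ 2 ≤ ‖x‖ ^ 2 * ‖D‖ ^ 2 := by
  rw [EuclideanSpace.real_norm_sq_eq, EuclideanSpace.real_norm_sq_eq, Fintype.sum_prod_type,
    Finset.mul_sum]
  refine Finset.sum_le_sum fun k _ => ?_
  rw [mul_comm]
  exact Finset.sum_mul_sq_le_sq_mul_sq _ _ _

theorem inner_netGrad (W D : Param d m) (x : Input d) :
    inner ℝ (netGrad φ u W x) D
      = ∑ k : Fin m, u k * (deriv φ (∑ j : Fin d, W (k, j) * x j)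
          * ∑ j : Fin d, D (k, j) * x j) := by
  simp only [PiLp.inner_apply, netGrad, Fintype.sum_prod_type, Finset.mul_sum]
  refine Finset.sum_congr rfl fun k _ => Finset.sum_congr rfl fun j _ => ?_
  simp; ring

theorem hasGradientAt_nnet (hφ : Differentiable ℝ φ) (W : Param d m) (x : Input d) :
    HasGradientAt (fun W => nnet φ u W x) (netGrad φ u W x) W := by
  have hs : ∀ k : Fin m, HasFDerivAt (fun W : Param d m => ∑ j : Fin d, W (k, j) * x j)
      (∑ j : Fin d, x j • (EuclideanSpace.proj (k, j) : Param d m →L[ℝ] ℝ)) W := by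
    intro k
    refine HasFDerivAt.fun_sum fun j _ => ?_
    exact (EuclideanSpace.proj (k, j) : Param d m →L[ℝ] ℝ).hasFDerivAt.mul_const (x j)
  have h : HasFDerivAt (fun W => nnet φ u W x) (∑ k : Fin m, u k •
      (deriv φ (∑ j : Fin d, W (k, j) * x j) •
        ∑ j : Fin d, x j • (EuclideanSpace.proj (k, j) : Param d m →L[ℝ] ℝ))) W := by
    unfold nnet
    refine HasFDerivAt.fun_sum fun k _ => ?_
    exact ((hφ _).hasDerivAt.comp_hasFDerivAt W (hs k)).const_mul (u k)
  rw [hasGradientAt_iff_hasFDerivAt]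
  refine h.congr_fderiv (ContinuousLinearMap.ext fun D => ?_)
  rw [InnerProductSpace.toDual_apply_apply, inner_netGrad]
  simp [mul_comm]

theorem abs_sq_weight (hu : ∀ k, u k = 1 / Real.sqrt m ∨ u k = -(1 / Real.sqrt m))
    (k : Fin m) : |u k| = 1 / Real.sqrt m ∧ u k ^ 2 = 1 / m := by
  have h0 : (0 : ℝ) ≤ m := Nat.cast_nonneg m
  rcases hu k with h | h <;> rw [h] <;>
    simp [abs_of_nonneg, Real.sqrt_nonneg, Real.sq_sqrt h0]

theorem abs_nnet_le (hm : 1 ≤ m) (hu : ∀ k, u k = 1 / Real.sqrt m ∨ u k = -(1 / Real.sqrt m))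
    {B : ℝ} (hB : ∀ s, |φ s| ≤ B) (W : Param d m) (x : Input d) :
    |nnet φ u W x| ≤ Real.sqrt m * B := by
  have hm0 : (0 : ℝ) < m := by exact_mod_cast hm
  calc |nnet φ u W x| ≤ ∑ k : Fin m, |u k * φ (∑ j : Fin d, W (k, j) * x j)| :=
        Finset.abs_sum_le_sum_abs _ _
    _ ≤ ∑ _k : Fin m, 1 / Real.sqrt m * B := by
        refine Finset.sum_le_sum fun k _ => ?_
        rw [abs_mul, (abs_sq_weight hu k).1]
        exact mul_le_mul_of_nonneg_left (hB _) (by positivity)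
    _ = Real.sqrt m * B := by
        rw [Finset.sum_const, Finset.card_univ, Fintype.card_fin, nsmul_eq_mul]
        have := Real.mul_self_sqrt hm0.le
        have hs := Real.sqrt_pos.2 hm0
        field_simp
        rw [sq, this]

theorem norm_sq_eq_sum_coeff_sq (c : Fin m → ℝ) (x : Input d) :
    ‖(WithLp.toLp 2 fun p : Fin m × Fin d => c p.1 * x p.2 : Param d m)‖ ^ 2
      = (∑ k, c k ^ 2) * ‖x‖ ^ 2 := by
  rw [EuclideanSpace.real_norm_sq_eq, EuclideanSpace.real_norm_sq_eq, Fintype.sum_prod_type,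
    Finset.sum_mul_sum]
  simp [mul_pow]

theorem norm_netGrad_le (hm : 1 ≤ m)
    (hu : ∀ k, u k = 1 / Real.sqrt m ∨ u k = -(1 / Real.sqrt m))
    {B C : ℝ} (hB : ∀ s, |deriv φ s| ≤ B) (hC : 0 ≤ C) (W : Param d m) {x : Input d}
    (hx : ‖x‖ ≤ C) : ‖netGrad φ u W x‖ ≤ B * C := by
  have hB0 : 0 ≤ B := (abs_nonneg _).trans (hB 0)
  have hm0 : (0 : ℝ) < m := by exact_mod_cast hm
  refine abs_le_of_sq_le_sq' ?_ (by positivity) |>.2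
  unfold netGrad
  rw [norm_sq_eq_sum_coeff_sq (fun k => u k * deriv φ (∑ j : Fin d, W (k, j) * x j)), mul_pow]
  have : ∑ k, (u k * deriv φ (∑ j : Fin d, W (k, j) * x j)) ^ 2 ≤ ∑ _k : Fin m, 1 / m * B ^ 2 := by
    refine Finset.sum_le_sum fun k _ => ?_
    rw [mul_pow, (abs_sq_weight hu k).2]
    refine mul_le_mul_of_nonneg_left ?_ (by positivity)
    exact sq_le_sq' (abs_le.1 (hB _)).1 (abs_le.1 (hB _)).2
  rw [Finset.sum_const, Finset.card_univ, Fintype.card_fin, nsmul_eq_mul] at this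
  have h2 : (m : ℝ) * (1 / m * B ^ 2) = B ^ 2 := by field_simp
  rw [h2] at this
  gcongr

theorem norm_netGrad_sub_le (hm : 1 ≤ m)
    (hu : ∀ k, u k = 1 / Real.sqrt m ∨ u k = -(1 / Real.sqrt m))
    (hφ' : Differentiable ℝ (deriv φ))
    {B C : ℝ} (hB : ∀ s, |deriv (deriv φ) s| ≤ B) (W V : Param d m) {x : Input d}
    (hx : ‖x‖ ≤ C) :
    ‖netGrad φ u W x - netGrad φ u V x‖ ≤ C ^ 2 * B / Real.sqrt m * ‖W - V‖ := by
  have hB0 : 0 ≤ B := (abs_nonneg _).trans (hB 0)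
  have hm0 : (0 : ℝ) < m := by exact_mod_cast hm
  have hlip : ∀ x y, |deriv φ x - deriv φ y| ≤ B * |x - y| := fun x y =>
    Convex.norm_image_sub_le_of_norm_deriv_le (f := deriv φ) (s := Set.univ)
      (fun x _ => hφ' x) (fun x _ => hB x) convex_univ (Set.mem_univ y) (Set.mem_univ x)
  refine abs_le_of_sq_le_sq' ?_ (by positivity) |>.2
  have hsub : netGrad φ u W x - netGrad φ u V x = WithLp.toLp 2 fun p : Fin m × Fin d =>
      (u p.1 * (deriv φ (∑ j : Fin d, W (p.1, j) * x j)
        - deriv φ (∑ j : Fin d, V (p.1, j) * x j))) * x p.2 := by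
    ext p
    simp [netGrad]; ring
  rw [hsub, norm_sq_eq_sum_coeff_sq (fun k => u k * (deriv φ (∑ j : Fin d, W (k, j) * x j)
        - deriv φ (∑ j : Fin d, V (k, j) * x j)))]
  have h1 : ∑ k, (u k * (deriv φ (∑ j : Fin d, W (k, j) * x j)
        - deriv φ (∑ j : Fin d, V (k, j) * x j))) ^ 2 ≤ B ^ 2 / m * (C ^ 2 * ‖W - V‖ ^ 2) := by
    calc _ ≤ ∑ k : Fin m, B ^ 2 / m * (∑ j : Fin d, (W - V) (k, j) * x j) ^ 2 := by
          refine Finset.sum_le_sum fun k _ => ?_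
          rw [mul_pow, (abs_sq_weight hu k).2]
          have h := hlip (∑ j : Fin d, W (k, j) * x j) (∑ j : Fin d, V (k, j) * x j)
          have he : ∑ j : Fin d, (W - V) (k, j) * x j
              = ∑ j : Fin d, W (k, j) * x j - ∑ j : Fin d, V (k, j) * x j := by
            rw [← Finset.sum_sub_distrib]
            exact Finset.sum_congr rfl fun j _ => by simp [sub_mul]
          rw [he, ← sq_abs (deriv φ _ - _), ← sq_abs (∑ j : Fin d, W (k, j) * x j - _)]
          have h2 := pow_le_pow_left₀ (abs_nonneg _) h 2
          rw [mul_pow] at h2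
          calc _ ≤ 1 / (m : ℝ) * (B ^ 2 * |∑ j : Fin d, W (k, j) * x j
                - ∑ j : Fin d, V (k, j) * x j| ^ 2) := by gcongr
            _ = _ := by ring
      _ ≤ _ := by
          rw [← Finset.mul_sum]
          gcongr
          refine (sum_preactivation_sq_le _ _).trans ?_
          gcongr
  calc _ ≤ B ^ 2 / m * (C ^ 2 * ‖W - V‖ ^ 2) * C ^ 2 := by gcongr
    _ = (C ^ 2 * B / Real.sqrt m * ‖W - V‖) ^ 2 := by
      rw [mul_pow, div_pow, Real.sq_sqrt hm0.le]; ring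

theorem abs_nnet_taylor_le (hm : 1 ≤ m)
    (hu : ∀ k, u k = 1 / Real.sqrt m ∨ u k = -(1 / Real.sqrt m))
    (hφ : Differentiable ℝ φ) (hφ' : Differentiable ℝ (deriv φ))
    {B C : ℝ} (hB : ∀ s, |deriv (deriv φ) s| ≤ B) (W V : Param d m) {x : Input d}
    (hx : ‖x‖ ≤ C) :
    |nnet φ u V x - nnet φ u W x - inner ℝ (netGrad φ u W x) (V - W)|
      ≤ C ^ 2 * B / Real.sqrt m / 2 * ‖V - W‖ ^ 2 := by
  have hB0 : 0 ≤ B := (abs_nonneg _).trans (hB 0)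
  rw [inner_netGrad]
  unfold nnet
  rw [← Finset.sum_sub_distrib, ← Finset.sum_sub_distrib]
  refine (Finset.abs_sum_le_sum_abs _ _).trans ?_
  calc _ ≤ ∑ k : Fin m, 1 / Real.sqrt m * (B / 2) * (∑ j : Fin d, (V - W) (k, j) * x j) ^ 2 := by
        refine Finset.sum_le_sum fun k _ => ?_
        have he : ∑ j : Fin d, (V - W) (k, j) * x j
            = ∑ j : Fin d, V (k, j) * x j - ∑ j : Fin d, W (k, j) * x j := by
          rw [← Finset.sum_sub_distrib]
          exact Finset.sum_congr rfl fun j _ => by simp [sub_mul]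
        rw [he, ← mul_sub, ← mul_sub, abs_mul, (abs_sq_weight hu k).1, mul_assoc]
        exact mul_le_mul_of_nonneg_left (abs_taylor_one_le hφ hφ' hB _ _) (by positivity)
    _ ≤ 1 / Real.sqrt m * (B / 2) * (C ^ 2 * ‖V - W‖ ^ 2) := by
        rw [← Finset.mul_sum]
        gcongr
        refine (sum_preactivation_sq_le _ _).trans ?_
        gcongr
    _ = _ := by ring

theorem abs_nnet_sub_le (hm : 1 ≤ m)
    (hu : ∀ k, u k = 1 / Real.sqrt m ∨ u k = -(1 / Real.sqrt m))
    (hφ : Differentiable ℝ φ) {B C : ℝ} (hB : ∀ s, |deriv φ s| ≤ B) (hC : 0 ≤ C)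
    (W V : Param d m) {x : Input d} (hx : ‖x‖ ≤ C) :
    |nnet φ u V x - nnet φ u W x| ≤ B * C * ‖V - W‖ := by
  refine Convex.norm_image_sub_le_of_norm_hasFDerivWithin_le (𝕜 := ℝ) (s := Set.univ)
    (f := fun W => nnet φ u W x)
    (f' := fun W => InnerProductSpace.toDual ℝ _ (netGrad φ u W x))
    (fun W _ => (hasGradientAt_nnet hφ W x).hasFDerivAt.hasFDerivWithinAt) (fun W _ => ?_)
    convex_univ (Set.mem_univ W) (Set.mem_univ V)
  rw [LinearIsometryEquiv.norm_map]
  exact norm_netGrad_le hm hu hB hC W hx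

theorem smoothResidual_nnet (hm : 1 ≤ m)
    (hu : ∀ k, u k = 1 / Real.sqrt m ∨ u k = -(1 / Real.sqrt m))
    (hφ : Differentiable ℝ φ) (hφ' : Differentiable ℝ (deriv φ)) {B0 B1 B2 Cx Cy : ℝ}
    (hB0 : ∀ s, |φ s| ≤ B0) (hB1 : ∀ s, |deriv φ s| ≤ B1) (hB2 : ∀ s, |deriv (deriv φ) s| ≤ B2)
    (hCx : 0 ≤ Cx) {z : Input d × ℝ} (hx : ‖z.1‖ ≤ Cx) (hy : |z.2| ≤ Cy) :
    SmoothResidual (B1 * Cx) (Cx ^ 2 * B2 / Real.sqrt m) (smoothConst m B0 B1 B2 Cx Cy)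
      (fun W => nnet φ u W z.1 - z.2) (fun W => netGrad φ u W z.1) where
  norm_grad_le W := norm_netGrad_le hm hu hB1 hCx W hx
  norm_grad_sub_le W V := norm_netGrad_sub_le hm hu hφ' hB2 W V hx
  abs_taylor_le W V := by
    rw [sub_sub_sub_cancel_right]
    exact abs_nnet_taylor_le hm hu hφ hφ' hB2 W V hx
  abs_sub_le W V := by
    rw [sub_sub_sub_cancel_right]
    exact abs_nnet_sub_le hm hu hφ hB1 hCx W V hx
  curvature_le W := by
    have h2 : 0 ≤ B2 := (abs_nonneg _).trans (hB2 0)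
    have hs : 0 < Real.sqrt m := Real.sqrt_pos.2 (by exact_mod_cast hm)
    have h : |nnet φ u W z.1 - z.2| ≤ Real.sqrt m * B0 + Cy :=
      (abs_sub _ _).trans (add_le_add (abs_nnet_le hm hu hB0 W z.1) hy)
    calc _ ≤ (Real.sqrt m * B0 + Cy) * (Cx ^ 2 * B2 / Real.sqrt m) + (B1 * Cx) ^ 2 := by gcongr
      _ = _ := by unfold smoothConst; field_simp; ring

end Network

section Averages

variable {E : Type*} {n : ℕ}

/-- The average `(1/n) ∑ᵢ hᵢ(W)² / 2`. -/
noncomputable def avgLoss (h : Fin n → E → ℝ) (W : E) : ℝ := (∑ i, h i W ^ 2 / 2) / n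

theorem avgLoss_nonneg (h : Fin n → E → ℝ) (W : E) : 0 ≤ avgLoss h W := by
  unfold avgLoss; positivity

theorem sum_sq_div_eq (h : Fin n → E → ℝ) (W : E) :
    (∑ i, h i W ^ 2) / n = 2 * avgLoss h W := by
  unfold avgLoss
  rw [← Finset.sum_div]; ring

theorem sum_abs_div_le (s : Finset (Fin n)) (a : Fin n → ℝ) :
    ((∑ i ∈ s, |a i|) / n) ^ 2 ≤ (∑ i ∈ s, a i ^ 2) / n := by
  rcases Nat.eq_zero_or_pos n with hn | hn
  · subst hn; simp
  have hn0 : (0 : ℝ) < n := by exact_mod_cast hn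
  have h1 : (∑ i ∈ s, |a i|) ^ 2 ≤ n * ∑ i ∈ s, a i ^ 2 := by
    refine sq_sum_le_card_mul_sum_sq.trans ?_
    simp only [sq_abs]
    refine mul_le_mul_of_nonneg_right ?_ (Finset.sum_nonneg fun i _ => sq_nonneg _)
    exact_mod_cast (Finset.card_le_univ s).trans (by simp)
  rw [div_pow, div_le_div_iff₀ (by positivity) hn0]
  nlinarith

/-- The mean absolute residual is at most the square root of twice the average loss. -/
theorem sum_abs_residual_div_le (s : Finset (Fin n)) (h : Fin n → E → ℝ) (W : E) {C : ℝ}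
    (hC : avgLoss h W ≤ C) : (∑ i ∈ s, |h i W|) / n ≤ Real.sqrt (2 * C) := by
  refine Real.le_sqrt_of_sq_le ((sum_abs_div_le s _).trans ?_)
  calc (∑ i ∈ s, h i W ^ 2) / (n : ℝ) ≤ (∑ i, h i W ^ 2) / n := by
        refine div_le_div_of_nonneg_right ?_ (Nat.cast_nonneg n)
        exact Finset.sum_le_sum_of_subset_of_nonneg (Finset.subset_univ s)
          fun _ _ _ => sq_nonneg _
    _ = 2 * avgLoss h W := sum_sq_div_eq h W
    _ ≤ 2 * C := by gcongr

variable [NormedAddCommGroup E] [InnerProductSpace ℝ E]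

/-- The gradient `(1/n) ∑ᵢ hᵢ(W) gᵢ(W)` of `avgLoss`. -/
noncomputable def avgGrad (h : Fin n → E → ℝ) (g : Fin n → E → E) (W : E) : E :=
  (n : ℝ)⁻¹ • ∑ i, h i W • g i W

theorem norm_avg_smul_le (s : Finset (Fin n)) (a : Fin n → ℝ) (v : Fin n → E) {G : ℝ}
    (hv : ∀ i, ‖v i‖ ≤ G) :
    ‖(n : ℝ)⁻¹ • ∑ i ∈ s, a i • v i‖ ≤ (∑ i ∈ s, |a i|) / n * G := by
  rw [norm_smul, norm_inv, Real.norm_natCast, div_mul_eq_mul_div, Finset.sum_mul, inv_mul_eq_div]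
  gcongr
  refine (norm_sum_le _ _).trans (Finset.sum_le_sum fun i _ => ?_)
  rw [norm_smul, Real.norm_eq_abs]
  exact mul_le_mul_of_nonneg_left (hv i) (abs_nonneg _)

theorem norm_avg_smul_sq_le (s : Finset (Fin n)) (a : Fin n → ℝ) (v : Fin n → E) {G : ℝ}
    (hv : ∀ i, ‖v i‖ ≤ G) :
    ‖(n : ℝ)⁻¹ • ∑ i ∈ s, a i • v i‖ ^ 2 ≤ (∑ i ∈ s, a i ^ 2) / n * G ^ 2 := by
  refine (pow_le_pow_left₀ (norm_nonneg _) (norm_avg_smul_le s a v hv) 2).trans ?_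
  rw [mul_pow]
  exact mul_le_mul_of_nonneg_right (sum_abs_div_le s a) (sq_nonneg G)

theorem inner_avgGrad (h : Fin n → E → ℝ) (g : Fin n → E → E) (W D : E) :
    inner ℝ (avgGrad h g W) D = (∑ i, h i W * inner ℝ (g i W) D) / n := by
  unfold avgGrad
  rw [real_inner_smul_left, sum_inner, inv_mul_eq_div]
  simp only [real_inner_smul_left]

end Averages

namespace SmoothResidual

variable {E : Type*} [NormedAddCommGroup E] [InnerProductSpace ℝ E] {G κ ρ : ℝ}
  {h : E → ℝ} {g : E → E}

theorem half_sq_le (H : SmoothResidual G κ ρ h g) (W V : E) :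
    h V ^ 2 / 2 ≤ h W ^ 2 / 2 + h W * inner ℝ (g W) (V - W) + ρ / 2 * ‖V - W‖ ^ 2 := by
  have h1 := H.abs_taylor_le W V
  have h2 := pow_le_pow_left₀ (abs_nonneg _) (H.abs_sub_le W V) 2
  rw [sq_abs, mul_pow] at h2
  have h3 := mul_le_mul_of_nonneg_right (H.curvature_le W) (sq_nonneg ‖V - W‖)
  have h4 : h W * (h V - h W - inner ℝ (g W) (V - W)) ≤ |h W| * (κ / 2 * ‖V - W‖ ^ 2) :=
    (le_abs_self _).trans (by rw [abs_mul]; gcongr)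
  nlinarith

theorem le_half_sq (H : SmoothResidual G κ ρ h g) (W V : E) :
    h W ^ 2 / 2 + h W * inner ℝ (g W) (V - W) - |h W| * (κ / 2 * ‖V - W‖ ^ 2) ≤ h V ^ 2 / 2 := by
  have h1 := H.abs_taylor_le W V
  have h4 : -(h W * (h V - h W - inner ℝ (g W) (V - W))) ≤ |h W| * (κ / 2 * ‖V - W‖ ^ 2) :=
    (neg_le_abs _).trans (by rw [abs_mul]; gcongr)
  nlinarith [sq_nonneg (h V - h W)]

theorem lipschitz_nonneg (H : SmoothResidual G κ ρ h g) : 0 ≤ G :=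
  (norm_nonneg _).trans (H.norm_grad_le 0)

end SmoothResidual

section Descent

variable {E : Type*} [NormedAddCommGroup E] [InnerProductSpace ℝ E] {n : ℕ} {G κ ρ η : ℝ}
  {h : Fin n → E → ℝ} {g : Fin n → E → E} {w : ℕ → E}

theorem avgLoss_le_quadratic (hn : 0 < n) (H : ∀ i, SmoothResidual G κ ρ (h i) (g i)) (W V : E) :
    avgLoss h V ≤ avgLoss h W + inner ℝ (avgGrad h g W) (V - W) + ρ / 2 * ‖V - W‖ ^ 2 := by
  have hn0 : (0 : ℝ) < n := by exact_mod_cast hn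
  rw [inner_avgGrad]
  unfold avgLoss
  rw [← add_div, div_add' _ _ _ hn0.ne']
  gcongr
  calc _ ≤ ∑ i, (h i W ^ 2 / 2 + h i W * inner ℝ (g i W) (V - W) + ρ / 2 * ‖V - W‖ ^ 2) :=
        Finset.sum_le_sum fun i _ => (H i).half_sq_le W V
    _ = _ := by
      rw [Finset.sum_add_distrib, Finset.sum_add_distrib, Finset.sum_const, Finset.card_univ,
        Fintype.card_fin, nsmul_eq_mul]
      ring

theorem le_avgLoss (hκ : 0 ≤ κ) (H : ∀ i, SmoothResidual G κ ρ (h i) (g i)) (W V : E)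
    {C : ℝ} (hC : avgLoss h W ≤ C) :
    avgLoss h W + inner ℝ (avgGrad h g W) (V - W) - Real.sqrt (2 * C) * (κ / 2 * ‖V - W‖ ^ 2)
      ≤ avgLoss h V := by
  rw [inner_avgGrad]
  have h1 := mul_le_mul_of_nonneg_right (sum_abs_residual_div_le Finset.univ h W hC)
    (show 0 ≤ κ / 2 * ‖V - W‖ ^ 2 by positivity)
  refine (sub_le_sub_left h1 _).trans ?_
  unfold avgLoss
  rw [← add_div, div_mul_eq_mul_div, ← sub_div, ← Finset.sum_add_distrib, Finset.sum_mul,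
    ← Finset.sum_sub_distrib]
  gcongr with i
  exact (H i).le_half_sq W V

theorem avgLoss_le_two_mul (hn : 0 < n) (H : ∀ i, SmoothResidual G κ ρ (h i) (g i)) (W V : E) :
    avgLoss h W ≤ 2 * avgLoss h V + G ^ 2 * ‖V - W‖ ^ 2 := by
  have hn0 : (0 : ℝ) < n := by exact_mod_cast hn
  unfold avgLoss
  rw [mul_div_assoc', div_add' _ _ _ hn0.ne']
  gcongr
  calc _ ≤ ∑ i, (2 * (h i V ^ 2 / 2) + G ^ 2 * ‖V - W‖ ^ 2) := by
        refine Finset.sum_le_sum fun i _ => ?_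
        have h2 := pow_le_pow_left₀ (abs_nonneg _) ((H i).abs_sub_le W V) 2
        rw [sq_abs, mul_pow] at h2
        nlinarith [sq_nonneg (2 * h i V - h i W)]
    _ = _ := by
      rw [Finset.sum_add_distrib, ← Finset.mul_sum, Finset.sum_const, Finset.card_univ,
        Fintype.card_fin, nsmul_eq_mul]
      ring

/-- Short horizons: moving away from `W` cannot reduce the regularized loss by much. -/
theorem avgLoss_mul_le (hn : 0 < n) (H : ∀ i, SmoothResidual G κ ρ (h i) (g i)) (W V : E)
    {τ : ℝ} (hτ : 0 < τ) :
    avgLoss h W * (1 - G ^ 2 * τ / 2) ≤ avgLoss h V + ‖V - W‖ ^ 2 / τ := by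
  have hn0 : (0 : ℝ) < n := by exact_mod_cast hn
  unfold avgLoss
  rw [div_mul_eq_mul_div, div_add' _ _ _ hn0.ne', Finset.sum_mul]
  gcongr
  calc _ ≤ ∑ i, (h i V ^ 2 / 2 + ‖V - W‖ ^ 2 / τ) := by
        refine Finset.sum_le_sum fun i _ => ?_
        have h1 := (H i).abs_sub_le W V
        have h2 : -(h i W * (h i V - h i W)) ≤ |h i W| * (G * ‖V - W‖) :=
          (neg_le_abs _).trans (by rw [abs_mul]; gcongr)
        have h3 : |h i W| * (G * ‖V - W‖) ≤ ‖V - W‖ ^ 2 / τ + |h i W| ^ 2 * G ^ 2 * τ / 4 := by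
          have h4 : ‖V - W‖ ^ 2 / τ + |h i W| ^ 2 * G ^ 2 * τ / 4 - |h i W| * (G * ‖V - W‖)
              = (‖V - W‖ - |h i W| * G * τ / 2) ^ 2 / τ := by field_simp; ring
          have h5 : 0 ≤ (‖V - W‖ - |h i W| * G * τ / 2) ^ 2 / τ := by positivity
          linarith
        rw [sq_abs] at h3
        nlinarith [sq_nonneg (h i V - h i W)]
    _ = _ := by
      rw [Finset.sum_add_distrib, Finset.sum_const, Finset.card_univ, Fintype.card_fin,
        nsmul_eq_mul]
      ring

/-- Data of a gradient-descent run on an average of smooth residuals. -/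
structure GDRun (G κ ρ η C : ℝ) (h : Fin n → E → ℝ) (g : Fin n → E → E) (w : ℕ → E) : Prop where
  pos : 0 < n
  step_pos : 0 < η
  step_le : η * (2 * ρ) ≤ 1
  curv_nonneg : 0 ≤ κ
  residual : ∀ i, SmoothResidual G κ ρ (h i) (g i)
  next : ∀ t, w (t + 1) = w t - η • avgGrad h g (w t)
  init_le : avgLoss h (w 0) ≤ C

namespace GDRun

variable {C : ℝ}

theorem lipschitz_nonneg (R : GDRun G κ ρ η C h g w) : 0 ≤ G :=
  (R.residual ⟨0, R.pos⟩).lipschitz_nonneg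

theorem step_mul_sq_le (R : GDRun G κ ρ η C h g w) : η * G ^ 2 ≤ 1 / 2 := by
  have h1 := (R.residual ⟨0, R.pos⟩).curvature_le 0
  have h2 := mul_nonneg (abs_nonneg (h ⟨0, R.pos⟩ 0)) R.curv_nonneg
  nlinarith [R.step_le, R.step_pos]

theorem bound_nonneg (R : GDRun G κ ρ η C h g w) : 0 ≤ C :=
  (avgLoss_nonneg h _).trans R.init_le

theorem descent (R : GDRun G κ ρ η C h g w) (t : ℕ) :
    η * ‖avgGrad h g (w t)‖ ^ 2 ≤ 4 / 3 * (avgLoss h (w t) - avgLoss h (w (t + 1))) := by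
  have h1 := avgLoss_le_quadratic R.pos R.residual (w t) (w (t + 1))
  have h2 : w (t + 1) - w t = -(η • avgGrad h g (w t)) := by rw [R.next]; abel
  rw [h2, inner_neg_right, real_inner_smul_right, real_inner_self_eq_norm_sq, norm_neg, norm_smul,
    mul_pow, Real.norm_eq_abs, sq_abs] at h1
  have h3 := mul_le_mul_of_nonneg_right R.step_le
    (show 0 ≤ η * ‖avgGrad h g (w t)‖ ^ 2 by have := R.step_pos; positivity)
  nlinarith

theorem avgLoss_succ_le (R : GDRun G κ ρ η C h g w) (t : ℕ) :
    avgLoss h (w (t + 1)) ≤ avgLoss h (w t) := by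
  have h1 := R.descent t
  have h2 : 0 ≤ η * ‖avgGrad h g (w t)‖ ^ 2 := by have := R.step_pos; positivity
  linarith

theorem antitone (R : GDRun G κ ρ η C h g w) : Antitone fun t => avgLoss h (w t) :=
  antitone_nat_of_succ_le R.avgLoss_succ_le

theorem avgLoss_le (R : GDRun G κ ρ η C h g w) (t : ℕ) : avgLoss h (w t) ≤ C :=
  (R.antitone (Nat.zero_le t)).trans R.init_le

theorem norm_sub_sq_le (R : GDRun G κ ρ η C h g w) (t : ℕ) :
    ‖w t - w 0‖ ^ 2 ≤ 4 / 3 * (η * t) * avgLoss h (w 0) := by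
  have h1 : ‖w t - w 0‖ ≤ ∑ s ∈ Finset.range t, ‖w (s + 1) - w s‖ := by
    rw [← Finset.sum_range_sub]
    exact norm_sum_le _ _
  have h2 : ‖w t - w 0‖ ^ 2 ≤ t * ∑ s ∈ Finset.range t, ‖w (s + 1) - w s‖ ^ 2 := by
    refine (pow_le_pow_left₀ (norm_nonneg _) h1 2).trans ?_
    simpa using sq_sum_le_card_mul_sum_sq (s := Finset.range t) (f := fun s => ‖w (s + 1) - w s‖)
  have h3 : ∑ s ∈ Finset.range t, ‖w (s + 1) - w s‖ ^ 2
      ≤ ∑ s ∈ Finset.range t, η * (4 / 3 * (avgLoss h (w s) - avgLoss h (w (s + 1)))) := by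
    refine Finset.sum_le_sum fun s _ => ?_
    have h4 : w (s + 1) - w s = -(η • avgGrad h g (w s)) := by rw [R.next]; abel
    rw [h4, norm_neg, norm_smul, mul_pow, Real.norm_eq_abs, sq_abs, sq η, mul_assoc]
    exact mul_le_mul_of_nonneg_left (R.descent s) R.step_pos.le
  rw [← Finset.mul_sum, ← Finset.mul_sum,
    Finset.sum_range_sub' (fun s => avgLoss h (w s))] at h3
  have h5 := avgLoss_nonneg h (w t)
  have h6 : η * (4 / 3 * (avgLoss h (w 0) - avgLoss h (w t)))
      ≤ η * (4 / 3 * avgLoss h (w 0)) := by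
    have := R.step_pos
    gcongr; linarith
  calc _ ≤ (t : ℝ) * (η * (4 / 3 * avgLoss h (w 0))) := by
        refine h2.trans ?_
        gcongr
        exact h3.trans h6
    _ = _ := by ring

theorem norm_sub_sq_le' (R : GDRun G κ ρ η C h g w) (t : ℕ) :
    ‖w t - w 0‖ ^ 2 ≤ 4 / 3 * (η * t) * C := by
  refine (R.norm_sub_sq_le t).trans ?_
  have := R.step_pos
  gcongr
  exact R.init_le

/-- One-step regret inequality against an arbitrary comparator. -/
theorem regret_step (R : GDRun G κ ρ η C h g w) (V : E) (t : ℕ) :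
    ‖w (t + 1) - V‖ ^ 2 + 2 * η * (avgLoss h (w (t + 1)) - avgLoss h V)
      ≤ (1 + η * κ * Real.sqrt (2 * C)) * ‖w t - V‖ ^ 2 := by
  have h1 := le_avgLoss R.curv_nonneg R.residual (w t) V (R.avgLoss_le t)
  have h2 : ‖w (t + 1) - V‖ ^ 2 = ‖w t - V‖ ^ 2
      + 2 * (η * inner ℝ (avgGrad h g (w t)) (V - w t)) + η * (η * ‖avgGrad h g (w t)‖ ^ 2) := by
    rw [R.next, show w t - η • avgGrad h g (w t) - V = (w t - V) - η • avgGrad h g (w t) by abel,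
      norm_sub_sq_real, real_inner_smul_right, norm_smul, mul_pow, Real.norm_eq_abs, sq_abs,
      real_inner_comm, ← neg_sub V (w t), inner_neg_right, norm_neg]
    ring
  have h3 := mul_le_mul_of_nonneg_left (R.descent t) R.step_pos.le
  have h4 := mul_le_mul_of_nonneg_left h1 R.step_pos.le
  have h5 := mul_le_mul_of_nonneg_left (R.avgLoss_succ_le t) R.step_pos.le
  rw [norm_sub_rev V (w t)] at h4
  rw [h2]
  nlinarith

theorem regret_of_forall_ge (R : GDRun G κ ρ η C h g w) (V : E) (t : ℕ)
    (hV : avgLoss h V ≤ avgLoss h (w t)) :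
    ‖w t - V‖ ^ 2 + 2 * η * ∑ s ∈ Finset.range t, (avgLoss h (w (s + 1)) - avgLoss h V)
      ≤ (1 + η * κ * Real.sqrt (2 * C)) ^ t * ‖w 0 - V‖ ^ 2 := by
  have hη := R.step_pos
  have hκ := R.curv_nonneg
  induction t with
  | zero => simp
  | succ t ih =>
    have h1 := ih (hV.trans (R.avgLoss_succ_le t))
    have h2 := R.regret_step V t
    have h3 : 0 ≤ ∑ s ∈ Finset.range t, (avgLoss h (w (s + 1)) - avgLoss h V) :=
      Finset.sum_nonneg fun s hs => sub_nonneg.2 <| hV.trans <| R.antitone <| by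
        have := Finset.mem_range.1 hs; omega
    have h0 : 0 ≤ η * κ * Real.sqrt (2 * C) := by positivity
    rw [Finset.sum_range_succ, pow_succ (1 + η * κ * Real.sqrt (2 * C))]
    have h4 := mul_le_mul_of_nonneg_left h1 (show 0 ≤ 1 + η * κ * Real.sqrt (2 * C) by linarith)
    have h5 := mul_nonneg h0 (mul_nonneg (mul_nonneg zero_le_two hη.le) h3)
    nlinarith

theorem sum_regret_le (R : GDRun G κ ρ η C h g w) (V : E) {T : ℕ}
    (hT : (1 + η * κ * Real.sqrt (2 * C)) ^ T ≤ 2) {t : ℕ} (ht : t ≤ T) :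
    ∑ s ∈ Finset.range t, (avgLoss h (w (s + 1)) - avgLoss h V) ≤ ‖w 0 - V‖ ^ 2 / η := by
  have hη := R.step_pos
  have hκ := R.curv_nonneg
  induction t with
  | zero => simp only [Finset.range_zero, Finset.sum_empty]; positivity
  | succ t ih =>
    rcases le_total (avgLoss h V) (avgLoss h (w (t + 1))) with hV | hV
    · have h1 := R.regret_of_forall_ge V (t + 1) hV
      have h2 : (1 + η * κ * Real.sqrt (2 * C)) ^ (t + 1) ≤ 2 :=
        (pow_le_pow_right₀ (by nlinarith [show 0 ≤ η * κ * Real.sqrt (2 * C) by positivity])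
          ht).trans hT
      have h3 := mul_le_mul_of_nonneg_right h2 (sq_nonneg ‖w 0 - V‖)
      rw [le_div_iff₀ hη]
      nlinarith [sq_nonneg ‖w (t + 1) - V‖]
    · rw [Finset.sum_range_succ]
      linarith [ih (by omega)]

/-- Small curvature: the last iterate and the averaged iterates compete with any comparator. -/
theorem optimization (R : GDRun G κ ρ η C h g w) {T : ℕ} (hT1 : 1 ≤ T)
    (hT : (1 + η * κ * Real.sqrt (2 * C)) ^ T ≤ 2) (V : E) :
    avgLoss h (w T) ≤ avgLoss h V + ‖V - w 0‖ ^ 2 / (η * T) ∧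
    (∑ t ∈ Finset.range T, avgLoss h (w t)) / T
      ≤ 3 * (avgLoss h V + ‖V - w 0‖ ^ 2 / (η * T)) := by
  have hη := R.step_pos
  have hT0 : (1 : ℝ) ≤ T := by exact_mod_cast hT1
  have h1 := R.sum_regret_le V hT le_rfl
  rw [Finset.sum_sub_distrib, Finset.sum_const, Finset.card_range, nsmul_eq_mul,
    norm_sub_rev] at h1
  have hq : ‖V - w 0‖ ^ 2 / (η * T) = ‖V - w 0‖ ^ 2 / η / T := by rw [div_div]
  set A := ‖V - w 0‖ ^ 2 / η with hA
  have hA0 : 0 ≤ A := by positivity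
  have hV := avgLoss_nonneg h V
  rw [hq]
  constructor
  · have h2 : (T : ℝ) * avgLoss h (w T) ≤ ∑ s ∈ Finset.range T, avgLoss h (w (s + 1)) := by
      calc (T : ℝ) * avgLoss h (w T) = ∑ _s ∈ Finset.range T, avgLoss h (w T) := by simp
        _ ≤ _ := Finset.sum_le_sum fun s hs => R.antitone (by
          have := Finset.mem_range.1 hs; omega)
    rw [← sub_le_iff_le_add', le_div_iff₀ (by linarith)]
    nlinarith
  · have h2 : ∑ s ∈ Finset.range T, avgLoss h (w s)
        ≤ ∑ s ∈ Finset.range T, avgLoss h (w (s + 1)) + avgLoss h (w 0) := by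
      rw [← Finset.sum_range_succ' (fun s => avgLoss h (w s)), Finset.sum_range_succ]
      linarith [avgLoss_nonneg h (w T)]
    have h3 := avgLoss_le_two_mul R.pos R.residual (w 0) V
    have h4 : G ^ 2 * ‖V - w 0‖ ^ 2 ≤ A := by
      rw [hA, le_div_iff₀ hη]
      nlinarith [R.step_mul_sq_le, sq_nonneg ‖V - w 0‖]
    rw [div_le_iff₀ (by linarith)]
    have h5 : 3 * (avgLoss h V + A / T) * T = 3 * avgLoss h V * T + 3 * A := by
      field_simp
    rw [h5]
    nlinarith

end GDRun

end Descent

section Stability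

variable {E : Type*} [NormedAddCommGroup E] [InnerProductSpace ℝ E] {n : ℕ} {G κ ρ η : ℝ}
  {h : Fin n → E → ℝ} {g : Fin n → E → E}

/-- A partial gradient step on smooth residuals is nearly nonexpansive. -/
theorem norm_partial_step_sub_le (hn : 0 < n) (hη : 0 ≤ η) (hκ : 0 ≤ κ) (hG : η * G ^ 2 ≤ 1 / 2)
    (H : ∀ i, SmoothResidual G κ ρ (h i) (g i)) (s : Finset (Fin n)) (W V : E) {M : ℝ}
    (hM : (∑ j ∈ s, |h j V|) / n ≤ M) :
    ‖W - V - η • ((n : ℝ)⁻¹ • ∑ j ∈ s, (h j W • g j W - h j V • g j V))‖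
      ≤ (1 + η * κ ^ 2 * ‖W - V‖ ^ 2 / 12 + η * κ * M) * ‖W - V‖ := by
  have hn0 : (0 : ℝ) < n := by exact_mod_cast hn
  set q : E := (n : ℝ)⁻¹ • ∑ j ∈ s, (h j W - h j V) • g j W with hq
  set p : E := (n : ℝ)⁻¹ • ∑ j ∈ s, h j V • (g j W - g j V) with hp
  have hsplit : W - V - η • ((n : ℝ)⁻¹ • ∑ j ∈ s, (h j W • g j W - h j V • g j V))
      = (W - V - η • q) - η • p := by
    rw [hq, hp, sub_sub (W - V), ← smul_add, ← smul_add, ← Finset.sum_add_distrib]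
    congr 3
    refine Finset.sum_congr rfl fun j _ => ?_
    rw [sub_smul, smul_sub]; abel
  have hp1 : ‖p‖ ≤ M * (κ * ‖W - V‖) :=
    (norm_avg_smul_le s _ _ fun j => (H j).norm_grad_sub_le W V).trans
      (mul_le_mul_of_nonneg_right hM (by positivity))
  have hq1 : ‖q‖ ^ 2 ≤ (∑ j ∈ s, (h j W - h j V) ^ 2) / n * G ^ 2 :=
    norm_avg_smul_sq_le s _ _ fun j => (H j).norm_grad_le W
  have hq2 : inner ℝ (W - V) q = (∑ j ∈ s, (h j W - h j V) * inner ℝ (g j W) (W - V)) / n := by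
    rw [hq, real_inner_comm, real_inner_smul_left, sum_inner, inv_mul_eq_div]
    simp only [real_inner_smul_left]
  have hsum : 1 / 2 * ((∑ j ∈ s, (h j W - h j V) ^ 2) / n) - 2 * inner ℝ (W - V) q
      ≤ κ ^ 2 * ‖W - V‖ ^ 4 / 6 := by
    rw [hq2, mul_div_assoc', mul_div_assoc', ← sub_div, div_le_iff₀ hn0, Finset.mul_sum,
      Finset.mul_sum, ← Finset.sum_sub_distrib]
    calc _ ≤ ∑ _j ∈ s, κ ^ 2 * ‖W - V‖ ^ 4 / 6 := by
          refine Finset.sum_le_sum fun j _ => ?_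
          have h1 := (H j).abs_taylor_le W V
          rw [← neg_sub W V, inner_neg_right, norm_neg] at h1
          have h2 := pow_le_pow_left₀ (abs_nonneg _) h1 2
          rw [sq_abs] at h2
          nlinarith [sq_nonneg (3 * (h j W - h j V)
            + 2 * (h j V - h j W - -inner ℝ (g j W) (W - V)))]
      _ ≤ _ := by
          rw [Finset.sum_const, nsmul_eq_mul, mul_comm]
          refine mul_le_mul_of_nonneg_left ?_ (by positivity)
          exact_mod_cast (Finset.card_le_univ s).trans (by simp)
  have hmain : ‖W - V - η • q‖ ≤ (1 + η * κ ^ 2 * ‖W - V‖ ^ 2 / 12) * ‖W - V‖ := by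
    refine abs_le_of_sq_le_sq' ?_ (by positivity) |>.2
    rw [norm_sub_sq_real, real_inner_smul_right, norm_smul, mul_pow, Real.norm_eq_abs, sq_abs]
    have h1 : η ^ 2 * ‖q‖ ^ 2 ≤ η * (1 / 2 * ((∑ j ∈ s, (h j W - h j V) ^ 2) / n)) := by
      have h2 : 0 ≤ (∑ j ∈ s, (h j W - h j V) ^ 2) / (n : ℝ) := by positivity
      calc η ^ 2 * ‖q‖ ^ 2 ≤ η ^ 2 * ((∑ j ∈ s, (h j W - h j V) ^ 2) / n * G ^ 2) := by gcongr
        _ = η * ((η * G ^ 2) * ((∑ j ∈ s, (h j W - h j V) ^ 2) / n)) := by ring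
        _ ≤ _ := by gcongr
    have h3 := mul_le_mul_of_nonneg_left hsum hη
    nlinarith [sq_nonneg (η * κ ^ 2 * ‖W - V‖ ^ 2 / 12 * ‖W - V‖)]
  rw [hsplit]
  calc _ ≤ ‖W - V - η • q‖ + ‖η • p‖ := norm_sub_le _ _
    _ ≤ (1 + η * κ ^ 2 * ‖W - V‖ ^ 2 / 12) * ‖W - V‖ + η * (M * (κ * ‖W - V‖)) := by
        rw [norm_smul, Real.norm_eq_abs, abs_of_nonneg hη]
        gcongr
    _ = _ := by ring

variable {h' : Fin n → E → ℝ} {g' : Fin n → E → E} {w w' : ℕ → E} {C : ℝ}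

namespace GDRun

theorem norm_sub_succ_le (R : GDRun G κ ρ η C h g w) (R' : GDRun G κ ρ η C h' g' w')
    (h0 : w 0 = w' 0) (i : Fin n) (hh : ∀ j, j ≠ i → h' j = h j) (hg : ∀ j, j ≠ i → g' j = g j)
    (t : ℕ) :
    ‖w (t + 1) - w' (t + 1)‖
      ≤ (1 + 4 / 9 * (η ^ 2 * κ ^ 2 * C) * t + η * κ * Real.sqrt (2 * C)) * ‖w t - w' t‖
        + η * G / n * (|h i (w t)| + |h' i (w' t)|) := by
  have hη := R.step_pos
  have hκ := R.curv_nonneg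
  have hC := R.bound_nonneg
  have hn0 : (0 : ℝ) < n := by exact_mod_cast R.pos
  have hG := R.lipschitz_nonneg
  have hM : (∑ j ∈ Finset.univ.erase i, |h j (w' t)|) / n ≤ Real.sqrt (2 * C) := by
    have h1 := sum_abs_residual_div_le (Finset.univ.erase i) h' (w' t) (R'.avgLoss_le t)
    have h2 : ∑ j ∈ Finset.univ.erase i, |h' j (w' t)|
        = ∑ j ∈ Finset.univ.erase i, |h j (w' t)| :=
      Finset.sum_congr rfl fun j hj => by rw [hh j (Finset.ne_of_mem_erase hj)]
    rwa [h2] at h1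
  have hstep := norm_partial_step_sub_le R.pos hη.le hκ R.step_mul_sq_le R.residual
    (Finset.univ.erase i) (w t) (w' t) hM
  have hsplit : w (t + 1) - w' (t + 1)
      = (w t - w' t - η • ((n : ℝ)⁻¹ • ∑ j ∈ Finset.univ.erase i,
          (h j (w t) • g j (w t) - h j (w' t) • g j (w' t))))
        - (η • ((n : ℝ)⁻¹ • (h i (w t) • g i (w t) - h' i (w' t) • g' i (w' t)))) := by
    rw [R.next, R'.next]
    unfold avgGrad
    rw [← Finset.sum_erase_add _ _ (Finset.mem_univ i),
      ← Finset.sum_erase_add _ (fun j => h' j (w' t) • g' j (w' t)) (Finset.mem_univ i)]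
    have h2 : ∑ j ∈ Finset.univ.erase i, h' j (w' t) • g' j (w' t)
        = ∑ j ∈ Finset.univ.erase i, h j (w' t) • g j (w' t) :=
      Finset.sum_congr rfl fun j hj => by
        rw [hh j (Finset.ne_of_mem_erase hj), hg j (Finset.ne_of_mem_erase hj)]
    rw [h2, Finset.sum_sub_distrib]
    simp only [smul_sub, smul_add]
    abel
  have hlast : ‖η • ((n : ℝ)⁻¹ • (h i (w t) • g i (w t) - h' i (w' t) • g' i (w' t)))‖
      ≤ η * G / n * (|h i (w t)| + |h' i (w' t)|) := by
    rw [norm_smul, norm_smul, norm_inv, Real.norm_natCast, Real.norm_eq_abs, abs_of_pos hη]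
    have h1 : ‖h i (w t) • g i (w t) - h' i (w' t) • g' i (w' t)‖
        ≤ G * (|h i (w t)| + |h' i (w' t)|) := by
      refine (norm_sub_le _ _).trans ?_
      rw [norm_smul, norm_smul, Real.norm_eq_abs, Real.norm_eq_abs]
      have h2 := mul_le_mul_of_nonneg_left ((R.residual i).norm_grad_le (w t))
        (abs_nonneg (h i (w t)))
      have h3 := mul_le_mul_of_nonneg_left ((R'.residual i).norm_grad_le (w' t))
        (abs_nonneg (h' i (w' t)))
      linarith
    calc _ ≤ η * ((n : ℝ)⁻¹ * (G * (|h i (w t)| + |h' i (w' t)|))) := by gcongr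
      _ = _ := by ring
  have hdist : ‖w t - w' t‖ ^ 2 ≤ 16 / 3 * (η * t) * C := by
    have h1 := R.norm_sub_sq_le' t
    have h2 := R'.norm_sub_sq_le' t
    have h3 : ‖w t - w' t‖ ≤ ‖w t - w 0‖ + ‖w' t - w' 0‖ := by
      rw [h0, norm_sub_rev (w' t)]
      exact norm_sub_le_norm_sub_add_norm_sub _ _ _
    have h4 := pow_le_pow_left₀ (norm_nonneg _) h3 2
    nlinarith [sq_nonneg (‖w t - w 0‖ - ‖w' t - w' 0‖)]
  rw [hsplit]
  refine (norm_sub_le _ _).trans (add_le_add (hstep.trans ?_) hlast)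
  refine mul_le_mul_of_nonneg_right ?_ (norm_nonneg _)
  have h1 := mul_le_mul_of_nonneg_left hdist (show 0 ≤ η * κ ^ 2 / 12 by positivity)
  nlinarith

theorem norm_sub_le_exp (R : GDRun G κ ρ η C h g w) (R' : GDRun G κ ρ η C h' g' w')
    (h0 : w 0 = w' 0) (i : Fin n) (hh : ∀ j, j ≠ i → h' j = h j) (hg : ∀ j, j ≠ i → g' j = g j)
    (t : ℕ) :
    ‖w t - w' t‖
      ≤ Real.exp (2 / 9 * (η ^ 2 * κ ^ 2 * C) * t ^ 2 + η * κ * Real.sqrt (2 * C) * t)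
        * (η * G / n * ∑ s ∈ Finset.range t, (|h i (w s)| + |h' i (w' s)|)) := by
  have hη := R.step_pos
  have hκ := R.curv_nonneg
  have hC := R.bound_nonneg
  have hG := R.lipschitz_nonneg
  induction t with
  | zero => simp [h0]
  | succ t ih =>
    set a := η ^ 2 * κ ^ 2 * C
    set b := η * κ * Real.sqrt (2 * C)
    have ha : 0 ≤ a := by positivity
    have hb : 0 ≤ b := by positivity
    rw [Finset.sum_range_succ, mul_add, mul_add]
    refine (R.norm_sub_succ_le R' h0 i hh hg t).trans (add_le_add ?_ ?_)
    · have h1 : 1 + 4 / 9 * a * t + b ≤ Real.exp (4 / 9 * a * t + b) := by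
        linarith [Real.add_one_le_exp (4 / 9 * a * t + b)]
      have hY : 0 ≤ η * G / n * ∑ s ∈ Finset.range t, (|h i (w s)| + |h' i (w' s)|) := by
        positivity
      calc _ ≤ Real.exp (4 / 9 * a * t + b) * (Real.exp (2 / 9 * a * t ^ 2 + b * t)
              * (η * G / n * ∑ s ∈ Finset.range t, (|h i (w s)| + |h' i (w' s)|))) := by gcongr
        _ = Real.exp ((4 / 9 * a * t + b) + (2 / 9 * a * t ^ 2 + b * t))
              * (η * G / n * ∑ s ∈ Finset.range t, (|h i (w s)| + |h' i (w' s)|)) := by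
            rw [Real.exp_add (4 / 9 * a * t + b)]; exact (mul_assoc _ _ _).symm
        _ ≤ _ := by
            refine mul_le_mul_of_nonneg_right (Real.exp_le_exp.2 ?_) hY
            push_cast
            nlinarith
    · refine le_mul_of_one_le_left (by positivity) (Real.one_le_exp (by positivity))

/-- On-average stability: effect on the loss at `i` of replacing the `i`-th residual. -/
theorem half_sq_sub_le (R : GDRun G κ ρ η C h g w) (R' : GDRun G κ ρ η C h' g' w')
    (h0 : w 0 = w' 0) (i : Fin n) (hh : ∀ j, j ≠ i → h' j = h j) (hg : ∀ j, j ≠ i → g' j = g j)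
    {T : ℕ} (hT : 1 ≤ T) {P : ℝ}
    (hP : Real.exp (2 / 9 * (η ^ 2 * κ ^ 2 * C) * T ^ 2 + η * κ * Real.sqrt (2 * C) * T) ≤ P) :
    h i (w' T) ^ 2 / 2 ≤ h i (w T) ^ 2 / 2
      + P * (G ^ 2 * (η * T) / n) * (h i (w T) ^ 2 / 2)
      + (2 * P * (G ^ 2 * (η * T) / n) + 2 * P ^ 2 * (G ^ 2 * (η * T) / n) ^ 2)
        * ((∑ t ∈ Finset.range T, (h i (w t) ^ 2 / 2 + h' i (w' t) ^ 2 / 2)) / T) := by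
  have hη := R.step_pos
  have hG := R.lipschitz_nonneg
  have hT0 : (0 : ℝ) < T := by exact_mod_cast hT
  have hP0 : 0 ≤ P := (Real.exp_pos _).le.trans hP
  set Y := ∑ s ∈ Finset.range T, (|h i (w s)| + |h' i (w' s)|) with hY
  set Z := (∑ t ∈ Finset.range T, (h i (w t) ^ 2 / 2 + h' i (w' t) ^ 2 / 2)) / (T : ℝ) with hZ
  have hY0 : 0 ≤ Y := by positivity
  have hYZ : Y ^ 2 ≤ 4 * T ^ 2 * Z := by
    have h1 : Y ^ 2 ≤ T * ∑ s ∈ Finset.range T, (|h i (w s)| + |h' i (w' s)|) ^ 2 := by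
      simpa using sq_sum_le_card_mul_sum_sq (s := Finset.range T)
        (f := fun s => |h i (w s)| + |h' i (w' s)|)
    have h2 : ∑ s ∈ Finset.range T, (|h i (w s)| + |h' i (w' s)|) ^ 2
        ≤ ∑ s ∈ Finset.range T, 4 * (h i (w s) ^ 2 / 2 + h' i (w' s) ^ 2 / 2) := by
      refine Finset.sum_le_sum fun s _ => ?_
      rw [← sq_abs (h i (w s)), ← sq_abs (h' i (w' s))]
      nlinarith [sq_nonneg (|h i (w s)| - |h' i (w' s)|)]
    rw [← Finset.mul_sum] at h2
    have h3 : 4 * (T : ℝ) ^ 2 * Z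
        = T * (4 * ∑ t ∈ Finset.range T, (h i (w t) ^ 2 / 2 + h' i (w' t) ^ 2 / 2)) := by
      rw [hZ]; field_simp
    rw [h3]
    exact h1.trans (by gcongr)
  set c := P * (η * G ^ 2 / n) with hc
  have hc0 : 0 ≤ c := by positivity
  have hδ : |h i (w' T) - h i (w T)| ≤ c * Y := by
    refine ((R.residual i).abs_sub_le (w T) (w' T)).trans ?_
    rw [norm_sub_rev]
    calc _ ≤ G * (P * (η * G / n * Y)) := by
          refine mul_le_mul_of_nonneg_left ?_ hG
          refine (R.norm_sub_le_exp R' h0 i hh hg T).trans ?_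
          exact mul_le_mul_of_nonneg_right hP (by positivity)
      _ = _ := by rw [hc]; ring
  have hδ2 := pow_le_pow_left₀ (abs_nonneg _) hδ 2
  rw [sq_abs, mul_pow] at hδ2
  have hx : h i (w T) * (h i (w' T) - h i (w T)) ≤ c * (T * h i (w T) ^ 2 / 2 + 2 * T * Z) := by
    calc _ ≤ |h i (w T)| * (c * Y) := (le_abs_self _).trans (by rw [abs_mul]; gcongr)
      _ = c * (|h i (w T)| * Y) := by ring
      _ ≤ _ := by
        refine mul_le_mul_of_nonneg_left ?_ hc0
        have h1 : T * (|h i (w T)| * Y) ≤ T * (T * h i (w T) ^ 2 / 2 + 2 * T * Z) := by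
          rw [← sq_abs (h i (w T))]
          nlinarith [sq_nonneg (T * |h i (w T)| - Y)]
        exact le_of_mul_le_mul_left h1 hT0
  have hcT : P * (G ^ 2 * (η * T) / n) = c * T := by rw [hc]; ring
  have hcT2 : P ^ 2 * (G ^ 2 * (η * T) / n) ^ 2 = c ^ 2 * T ^ 2 := by rw [hc]; ring
  rw [mul_assoc 2 P, hcT, mul_assoc 2 (P ^ 2), hcT2]
  have h5 := mul_le_mul_of_nonneg_left hYZ (sq_nonneg c)
  nlinarith

end GDRun

end Stability

section Exchange

variable {Z : Type*} [MeasurableSpace Z] (μ : Measure Z) [IsProbabilityMeasure μ] {n : ℕ}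

theorem measurePreserving_tail :
    MeasurePreserving (fun ω : Fin (n + 1) → Z => (Fin.tail ω : Fin n → Z))
      (Measure.pi fun _ => μ) (Measure.pi fun _ => μ) :=
  measurePreserving_snd.comp (measurePreserving_piFinSuccAbove (fun _ : Fin (n + 1) => μ) 0)

theorem measurePreserving_comp_perm {ι : Type*} [Fintype ι] (σ : Equiv.Perm ι) :
    MeasurePreserving (fun ω : ι → Z => ω ∘ σ) (Measure.pi fun _ => μ) (Measure.pi fun _ => μ) := by
  have := measurePreserving_piCongrLeft (fun _ : ι => μ) σ.symm
  convert this using 1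
  ext ω i
  simp [MeasurableEquiv.piCongrLeft, Equiv.piCongrLeft, Equiv.piCongrLeft']

theorem integral_comp_perm {ι : Type*} [Fintype ι] (σ : Equiv.Perm ι) {F : (ι → Z) → ℝ}
    (hF : Measurable F) :
    ∫ ω, F (ω ∘ σ) ∂(Measure.pi fun _ => μ) = ∫ ω, F ω ∂(Measure.pi fun _ => μ) := by
  have h := measurePreserving_comp_perm μ σ
  conv_rhs => rw [← h.map_eq]
  rw [integral_map h.measurable.aemeasurable hF.aestronglyMeasurable]

theorem integral_comp_tail {F : (Fin n → Z) → ℝ} (hF : Measurable F) :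
    ∫ ω : Fin (n + 1) → Z, F (Fin.tail ω) ∂(Measure.pi fun _ => μ)
      = ∫ S, F S ∂(Measure.pi fun _ => μ) := by
  have h := measurePreserving_tail (n := n) μ
  conv_rhs => rw [← h.map_eq]
  rw [integral_map h.measurable.aemeasurable hF.aestronglyMeasurable]

theorem integral_tail_head {F : (Fin n → Z) → Z → ℝ} (hF : Measurable (Function.uncurry F))
    {K : ℝ} (hK : ∀ S, ∀ᵐ z ∂μ, |F S z| ≤ K) :
    ∫ ω : Fin (n + 1) → Z, F (Fin.tail ω) (ω 0) ∂(Measure.pi fun _ => μ)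
      = ∫ S, ∫ z, F S z ∂μ ∂(Measure.pi fun _ => μ) := by
  have h := measurePreserving_piFinSuccAbove (fun _ : Fin (n + 1) => μ) 0
  have hi : Integrable (fun p : (Fin n → Z) × Z => F p.1 p.2) ((Measure.pi fun _ => μ).prod μ) := by
    refine Integrable.of_bound hF.aestronglyMeasurable K ?_
    have : MeasurableSet {p : (Fin n → Z) × Z | ‖F p.1 p.2‖ ≤ K} :=
      measurableSet_le hF.norm measurable_const
    rw [Measure.ae_prod_iff_ae_ae this]
    exact Filter.Eventually.of_forall hK
  have h2 := h.integral_comp' (fun p : Z × (Fin n → Z) => F p.2 p.1)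
  have h3 := integral_prod_symm (fun p : Z × (Fin n → Z) => F p.2 p.1) hi.swap
  exact h2.trans h3

theorem ae_pi_forall {ι : Type*} [Fintype ι] {p : Z → Prop} (hp : ∀ᵐ z ∂μ, p z) :
    ∀ᵐ ω : ι → Z ∂(Measure.pi fun _ => μ), ∀ i, p (ω i) :=
  ae_all_iff.2 fun i => (Measure.quasiMeasurePreserving_eval (fun _ => μ) i).ae hp

/-- The sample obtained from the tail of `ω` by replacing the `i`-th point by `ω 0`. -/
def swapHead (i : Fin n) (ω : Fin (n + 1) → Z) : Fin (n + 1) → Z := ω ∘ Equiv.swap 0 i.succ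

/-- Generalization from on-average stability. -/
theorem integral_risk_le_of_stability (hn : 0 < n) {T : ℕ} (l : ℕ → (Fin n → Z) → Z → ℝ)
    (hl : ∀ t, Measurable (Function.uncurry (l t))) {K A B : ℝ}
    (hK : ∀ᵐ z ∂μ, ∀ t S, |l t S z| ≤ K)
    (hstab : ∀ᵐ ω : Fin (n + 1) → Z ∂(Measure.pi fun _ => μ), ∀ i : Fin n,
      l T (Fin.tail (swapHead i ω)) (ω i.succ) ≤ (1 + A) * l T (Fin.tail ω) (ω i.succ)
        + B * ((∑ t ∈ Finset.range T,
          (l t (Fin.tail ω) (ω i.succ) + l t (Fin.tail (swapHead i ω)) (ω 0))) / T)) :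
    ∫ S, ∫ z, l T S z ∂μ ∂(Measure.pi fun _ : Fin n => μ)
      ≤ (1 + A) * ∫ S, (∑ i, l T S (S i)) / n ∂(Measure.pi fun _ : Fin n => μ)
        + 2 * B * ∫ S, (∑ t ∈ Finset.range T, (∑ i, l t S (S i)) / n) / T
            ∂(Measure.pi fun _ : Fin n => μ) := by
  have hn0 : (0 : ℝ) < n := by exact_mod_cast hn
  have htail : Measurable fun ω : Fin (n + 1) → Z => (Fin.tail ω : Fin n → Z) :=
    (measurePreserving_tail μ).measurable
  have hswap : ∀ i : Fin n, Measurable (swapHead (Z := Z) i) := fun i =>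
    (measurePreserving_comp_perm μ (Equiv.swap 0 i.succ)).measurable
  have hm1 : ∀ t (i : Fin n), Measurable fun ω : Fin (n + 1) → Z =>
      l t (Fin.tail ω) (ω i.succ) := fun t i =>
    (hl t).comp (htail.prodMk (measurable_pi_apply i.succ))
  have hm2 : ∀ t (i : Fin n) j, Measurable fun ω : Fin (n + 1) → Z =>
      l t (Fin.tail (swapHead i ω)) (ω j) := fun t i j =>
    (hl t).comp ((htail.comp (hswap i)).prodMk (measurable_pi_apply j))
  have hm3 : ∀ t (i : Fin n), Measurable fun S : Fin n → Z => l t S (S i) := fun t i =>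
    (hl t).comp (measurable_id.prodMk (measurable_pi_apply i))
  have hgood := ae_pi_forall (ι := Fin (n + 1)) μ hK
  have hgood' := ae_pi_forall (ι := Fin n) μ hK
  have hi1 : ∀ t (i : Fin n), Integrable (fun ω : Fin (n + 1) → Z => l t (Fin.tail ω) (ω i.succ))
      (Measure.pi fun _ => μ) := fun t i =>
    Integrable.of_bound (hm1 t i).aestronglyMeasurable K
      (hgood.mono fun ω h => h i.succ t _)
  have hi2 : ∀ t (i : Fin n) j, Integrable (fun ω : Fin (n + 1) → Z =>
      l t (Fin.tail (swapHead i ω)) (ω j)) (Measure.pi fun _ => μ) := fun t i j =>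
    Integrable.of_bound (hm2 t i j).aestronglyMeasurable K
      (hgood.mono fun ω h => h j t _)
  have hi3 : ∀ t (i : Fin n), Integrable (fun S : Fin n → Z => l t S (S i))
      (Measure.pi fun _ => μ) := fun t i =>
    Integrable.of_bound (hm3 t i).aestronglyMeasurable K
      (hgood'.mono fun ω h => h i t _)
  have he1 : ∀ t (i : Fin n), ∫ ω : Fin (n + 1) → Z, l t (Fin.tail ω) (ω i.succ)
      ∂(Measure.pi fun _ => μ) = ∫ S, l t S (S i) ∂(Measure.pi fun _ => μ) := fun t i =>
    integral_comp_tail μ (hm3 t i)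
  have he2 : ∀ t (i : Fin n), ∫ ω : Fin (n + 1) → Z, l t (Fin.tail (swapHead i ω)) (ω 0)
      ∂(Measure.pi fun _ => μ) = ∫ S, l t S (S i) ∂(Measure.pi fun _ => μ) := fun t i => by
    rw [← he1, ← integral_comp_perm μ (Equiv.swap 0 i.succ) (hm1 t i)]
    simp [swapHead]
  have he3 : ∀ i : Fin n, ∫ ω : Fin (n + 1) → Z, l T (Fin.tail (swapHead i ω)) (ω i.succ)
      ∂(Measure.pi fun _ => μ) = ∫ S, ∫ z, l T S z ∂μ ∂(Measure.pi fun _ => μ) := fun i => by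
    rw [← integral_tail_head μ (hl T) (fun S => hK.mono fun z h => h T S),
      ← integral_comp_perm μ (Equiv.swap 0 i.succ)
        (F := fun ω : Fin (n + 1) → Z => l T (Fin.tail ω) (ω 0))
        ((hl T).comp (htail.prodMk (measurable_pi_apply 0)))]
    simp [swapHead]
  have hi4 : ∀ t (i : Fin n), Integrable (fun ω : Fin (n + 1) → Z =>
      l t (Fin.tail ω) (ω i.succ) + l t (Fin.tail (swapHead i ω)) (ω 0))
      (Measure.pi fun _ => μ) := fun t i => (hi1 t i).add (hi2 t i 0)
  have hmain : ∀ i : Fin n, ∫ S, ∫ z, l T S z ∂μ ∂(Measure.pi fun _ : Fin n => μ)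
      ≤ (1 + A) * ∫ S, l T S (S i) ∂(Measure.pi fun _ : Fin n => μ)
        + 2 * B * ((∑ t ∈ Finset.range T, ∫ S, l t S (S i) ∂(Measure.pi fun _ : Fin n => μ)) / T) := by
    intro i
    have hs : Integrable (fun ω : Fin (n + 1) → Z => ∑ t ∈ Finset.range T,
        (l t (Fin.tail ω) (ω i.succ) + l t (Fin.tail (swapHead i ω)) (ω 0)))
        (Measure.pi fun _ => μ) :=
      integrable_finsetSum _ fun t _ => hi4 t i
    have h1 := integral_mono_ae (hi2 T i i.succ)
      (((hi1 T i).const_mul (1 + A)).add ((hs.div_const (T : ℝ)).const_mul B))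
      (hstab.mono fun ω h => h i)
    have h2 : ∫ ω : Fin (n + 1) → Z, ∑ t ∈ Finset.range T,
        (l t (Fin.tail ω) (ω i.succ) + l t (Fin.tail (swapHead i ω)) (ω 0))
        ∂(Measure.pi fun _ => μ)
        = 2 * ∑ t ∈ Finset.range T, ∫ S, l t S (S i) ∂(Measure.pi fun _ : Fin n => μ) := by
      rw [integral_finsetSum _ fun t _ => hi4 t i, Finset.mul_sum]
      refine Finset.sum_congr rfl fun t _ => ?_
      rw [integral_add (hi1 t i) (hi2 t i 0), he1, he2, two_mul]
    rw [he3, integral_add' ((hi1 T i).const_mul (1 + A)) ((hs.div_const (T : ℝ)).const_mul B),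
      integral_const_mul, integral_const_mul, integral_div, he1, h2] at h1
    calc _ ≤ _ := h1
      _ = _ := by ring
  have havg : ∀ t, ∫ S, (∑ i, l t S (S i)) / n ∂(Measure.pi fun _ : Fin n => μ)
      = (∑ i, ∫ S, l t S (S i) ∂(Measure.pi fun _ : Fin n => μ)) / n := fun t => by
    rw [integral_div, integral_finsetSum _ fun i _ => hi3 t i]
  rw [havg, integral_div (T : ℝ), integral_finsetSum _ fun t _ =>
    (integrable_finsetSum _ fun i _ => hi3 t i).div_const (n : ℝ)]
  simp only [havg]
  have hsum := Finset.sum_le_sum fun (i : Fin n) (_ : i ∈ Finset.univ) => hmain i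
  rw [Finset.sum_const, Finset.card_univ, Fintype.card_fin, nsmul_eq_mul,
    Finset.sum_add_distrib, ← Finset.mul_sum, ← Finset.mul_sum, ← Finset.sum_div,
    Finset.sum_comm] at hsum
  rw [← Finset.sum_div]
  refine le_of_mul_le_mul_left (hsum.trans (le_of_eq ?_)) hn0
  field_simp

end Exchange

section Deviation

variable {Z : Type*} [MeasurableSpace Z]

/-- The deviation `E_μ q - (1/n) ∑ᵢ q(Sᵢ)` of the empirical mean of `q`. -/
noncomputable def meanDev {n : ℕ} (μ : Measure Z) (q : Z → ℝ) (S : Fin n → Z) : ℝ :=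
  ∫ z, q z ∂μ - (∑ i, q (S i)) / n

variable (μ : Measure Z) {n : ℕ}

theorem meanDev_add {p q : Z → ℝ} (hp : Integrable p μ) (hq : Integrable q μ) (S : Fin n → Z) :
    meanDev μ (fun z => p z + q z) S = meanDev μ p S + meanDev μ q S := by
  unfold meanDev
  rw [integral_add hp hq, Finset.sum_add_distrib]
  ring

theorem meanDev_const_mul (r : ℝ) (q : Z → ℝ) (S : Fin n → Z) :
    meanDev μ (fun z => r * q z) S = r * meanDev μ q S := by
  unfold meanDev
  rw [integral_const_mul, ← Finset.mul_sum]
  ring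

theorem meanDev_sum {ι : Type*} (s : Finset ι) {q : ι → Z → ℝ} (hq : ∀ p, Integrable (q p) μ)
    (S : Fin n → Z) :
    meanDev μ (fun z => ∑ p ∈ s, q p z) S = ∑ p ∈ s, meanDev μ (q p) S := by
  unfold meanDev
  rw [integral_finsetSum _ fun p _ => hq p, Finset.sum_comm, Finset.sum_div,
    Finset.sum_sub_distrib]

theorem measurable_meanDev {q : Z → ℝ} (hq : Measurable q) :
    Measurable (meanDev (n := n) μ q) := by
  unfold meanDev
  refine measurable_const.sub (Measurable.div_const ?_ _)
  exact Finset.measurable_fun_sum _ fun i _ => hq.comp (measurable_pi_apply i)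

variable [IsProbabilityMeasure μ]

theorem ae_abs_meanDev_le (hn : 0 < n) {q : Z → ℝ} {K : ℝ}
    (hK : ∀ᵐ z ∂μ, |q z| ≤ K) :
    ∀ᵐ S : Fin n → Z ∂(Measure.pi fun _ => μ), |meanDev μ q S| ≤ 2 * K := by
  have hn0 : (0 : ℝ) < n := by exact_mod_cast hn
  filter_upwards [ae_pi_forall (ι := Fin n) μ hK] with S hS
  have h1 : |∫ z, q z ∂μ| ≤ K := by
    have := norm_integral_le_of_norm_le_const (f := q) hK
    simpa using this
  have h2 : |(∑ i, q (S i)) / (n : ℝ)| ≤ K := by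
    rw [abs_div, abs_of_pos hn0, div_le_iff₀ hn0]
    refine (Finset.abs_sum_le_sum_abs _ _).trans ?_
    calc _ ≤ ∑ _i : Fin n, K := Finset.sum_le_sum fun i _ => hS i
      _ = _ := by simp [mul_comm]
  unfold meanDev
  linarith [abs_sub (∫ z, q z ∂μ) ((∑ i, q (S i)) / (n : ℝ))]

theorem integrable_meanDev (hn : 0 < n) {q : Z → ℝ} (hq : Measurable q) {K : ℝ}
    (hK : ∀ᵐ z ∂μ, |q z| ≤ K) :
    Integrable (meanDev (n := n) μ q) (Measure.pi fun _ => μ) :=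
  Integrable.of_bound (measurable_meanDev μ hq).aestronglyMeasurable (2 * K)
    (ae_abs_meanDev_le μ hn hK)

theorem integrable_meanDev_sq (hn : 0 < n) {q : Z → ℝ} (hq : Measurable q) {K : ℝ}
    (hK : ∀ᵐ z ∂μ, |q z| ≤ K) :
    Integrable (fun S => meanDev (n := n) μ q S ^ 2) (Measure.pi fun _ => μ) := by
  refine Integrable.of_bound ((measurable_meanDev μ hq).pow_const 2).aestronglyMeasurable
    ((2 * K) ^ 2) ((ae_abs_meanDev_le μ hn hK).mono fun S hS => ?_)
  rw [Real.norm_eq_abs, abs_pow]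
  exact pow_le_pow_left₀ (abs_nonneg _) hS 2

theorem integral_empirical_mean (hn : 0 < n) {q : Z → ℝ} (hq : Measurable q) {K : ℝ}
    (hK : ∀ᵐ z ∂μ, |q z| ≤ K) :
    ∫ S : Fin n → Z, (∑ i, q (S i)) / n ∂(Measure.pi fun _ => μ) = ∫ z, q z ∂μ := by
  have hn0 : (0 : ℝ) < n := by exact_mod_cast hn
  have hi : ∀ i : Fin n, Integrable (fun S : Fin n → Z => q (S i)) (Measure.pi fun _ => μ) :=
    fun i => Integrable.of_bound (hq.comp (measurable_pi_apply i)).aestronglyMeasurable K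
      ((ae_pi_forall (ι := Fin n) μ hK).mono fun S hS => hS i)
  rw [integral_div, integral_finsetSum _ fun i _ => hi i]
  have he : ∀ i : Fin n, ∫ S : Fin n → Z, q (S i) ∂(Measure.pi fun _ => μ) = ∫ z, q z ∂μ :=
    fun i => integral_comp_eval (μ := fun _ : Fin n => μ) (i := i) hq.aestronglyMeasurable
  simp [he]
  field_simp

theorem integral_meanDev (hn : 0 < n) {q : Z → ℝ} (hq : Measurable q) {K : ℝ}
    (hK : ∀ᵐ z ∂μ, |q z| ≤ K) :
    ∫ S : Fin n → Z, meanDev μ q S ∂(Measure.pi fun _ => μ) = 0 := by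
  have hi : Integrable (fun S : Fin n → Z => (∑ i, q (S i)) / (n : ℝ)) (Measure.pi fun _ => μ) := by
    refine Integrable.div_const (integrable_finsetSum _ fun i _ => ?_) _
    exact Integrable.of_bound (hq.comp (measurable_pi_apply i)).aestronglyMeasurable K
      ((ae_pi_forall (ι := Fin n) μ hK).mono fun S hS => hS i)
  unfold meanDev
  rw [integral_sub (integrable_const _) hi, integral_empirical_mean μ hn hq hK]
  simp

theorem integral_meanDev_sq_le (hn : 0 < n) {q : Z → ℝ} (hq : Measurable q) {K : ℝ}
    (hK : ∀ᵐ z ∂μ, |q z| ≤ K) :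
    ∫ S : Fin n → Z, meanDev μ q S ^ 2 ∂(Measure.pi fun _ => μ) ≤ (∫ z, q z ^ 2 ∂μ) / n := by
  have hn0 : (0 : ℝ) < n := by exact_mod_cast hn
  have hmem : MemLp q 2 μ := MemLp.of_bound hq.aestronglyMeasurable K hK
  have h1 := ProbabilityTheory.variance_sum_pi (μ := fun _ : Fin n => μ)
    (X := fun _ : Fin n => q) fun _ => hmem
  have h2 : ProbabilityTheory.variance q μ ≤ ∫ z, q z ^ 2 ∂μ :=
    ProbabilityTheory.variance_le_expectation_sq hq.aestronglyMeasurable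
  have hfun : (∑ i : Fin n, fun ω : Fin n → Z => q (ω i)) = fun ω => ∑ i, q (ω i) := by
    ext ω; simp
  have hmeas : Measurable fun ω : Fin n → Z => ∑ i, q (ω i) :=
    Finset.measurable_fun_sum _ fun i _ => hq.comp (measurable_pi_apply i)
  have hmean : ∫ S : Fin n → Z, ∑ i, q (S i) ∂(Measure.pi fun _ => μ) = n * ∫ z, q z ∂μ := by
    have := integral_empirical_mean μ hn hq hK
    rw [integral_div, div_eq_iff hn0.ne'] at this
    rw [this, mul_comm]
  rw [hfun, ProbabilityTheory.variance_eq_integral hmeas.aemeasurable, hmean, Finset.sum_const,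
    Finset.card_univ, Fintype.card_fin, nsmul_eq_mul] at h1
  have h3 : ∀ S : Fin n → Z, meanDev μ q S ^ 2
      = (∑ i, q (S i) - n * ∫ z, q z ∂μ) ^ 2 / (n : ℝ) ^ 2 := by
    intro S
    unfold meanDev
    field_simp
    ring
  simp only [h3]
  rw [integral_div, h1]
  calc _ = ProbabilityTheory.variance q μ / n := by field_simp
    _ ≤ _ := by gcongr

/-- Uniform deviation of the quadratics `v ↦ (a + ⟨ψ, v⟩)² / 2` over a ball. -/
theorem exists_uniform_quadratic_deviation (hn : 0 < n) {ι : Type*} [Fintype ι]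
    {a : Z → ℝ} {ψ : Z → EuclideanSpace ℝ ι} (ha : Measurable a)
    (hψ : Measurable ψ) {α G R c c' : ℝ} (hα : ∀ᵐ z ∂μ, a z ^ 2 ≤ α)
    (hG : ∀ᵐ z ∂μ, ‖ψ z‖ ≤ G) (hc : 0 < c) (hc' : 0 < c') :
    ∃ U : (Fin n → Z) → ℝ, Integrable U (Measure.pi fun _ => μ) ∧
      ∫ S, U S ∂(Measure.pi fun _ => μ) ≤ c / 2 * R ^ 2 * (α * G ^ 2 / n) + 1 / (2 * c)
        + c' / 4 * R ^ 4 * (G ^ 4 / n) + 1 / (4 * c') ∧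
      ∀ S v, ‖v‖ ≤ R → ∫ z, (a z + inner ℝ (ψ z) v) ^ 2 / 2 ∂μ
        ≤ (∑ i, (a (S i) + inner ℝ (ψ (S i)) v) ^ 2 / 2) / n + U S := by
  have hψp : ∀ p, Measurable fun z => ψ z p := fun p => by fun_prop
  have hcoord : ∀ᵐ z ∂μ, ∀ p, |ψ z p| ≤ G := hG.mono fun z hz p =>
    (PiLp.norm_apply_le (ψ z) p).trans hz
  have haabs : ∀ᵐ z ∂μ, |a z| ≤ Real.sqrt α := hα.mono fun z hz => Real.abs_le_sqrt hz
  have hb0 : ∀ᵐ z ∂μ, |a z ^ 2| ≤ α := hα.mono fun z hz => by rwa [abs_of_nonneg (sq_nonneg _)]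
  have hb1 : ∀ p, ∀ᵐ z ∂μ, |a z * ψ z p| ≤ Real.sqrt α * G := fun p => by
    filter_upwards [haabs, hcoord] with z h1 h2
    rw [abs_mul]
    exact mul_le_mul h1 (h2 p) (abs_nonneg _) (Real.sqrt_nonneg _)
  have hb2 : ∀ p q, ∀ᵐ z ∂μ, |ψ z p * ψ z q| ≤ G * G := fun p q => by
    filter_upwards [hcoord] with z h2
    rw [abs_mul]
    exact mul_le_mul (h2 p) (h2 q) (abs_nonneg _) ((abs_nonneg _).trans (h2 p))
  have hm0 : Measurable fun z => a z ^ 2 := ha.pow_const 2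
  have hm1 : ∀ p, Measurable fun z => a z * ψ z p := fun p => ha.mul (hψp p)
  have hm2 : ∀ p q, Measurable fun z => ψ z p * ψ z q := fun p q => (hψp p).mul (hψp q)
  have hi0 : Integrable (fun z => a z ^ 2) μ := Integrable.of_bound hm0.aestronglyMeasurable _ hb0
  have hi1 : ∀ p, Integrable (fun z => a z * ψ z p) μ := fun p =>
    Integrable.of_bound (hm1 p).aestronglyMeasurable _ (hb1 p)
  have hi2 : ∀ p q, Integrable (fun z => ψ z p * ψ z q) μ := fun p q =>
    Integrable.of_bound (hm2 p q).aestronglyMeasurable _ (hb2 p q)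
  have hnorm : ∀ x : EuclideanSpace ℝ ι, ‖x‖ ^ 2 = ∑ p, x p ^ 2 := EuclideanSpace.real_norm_sq_eq
  have hQ1i : ∀ p, Integrable (fun S : Fin n → Z => meanDev μ (fun z => a z * ψ z p) S ^ 2)
      (Measure.pi fun _ => μ) := fun p => integrable_meanDev_sq μ hn (hm1 p) (hb1 p)
  have hQ2i : ∀ p q, Integrable (fun S : Fin n → Z => meanDev μ (fun z => ψ z p * ψ z q) S ^ 2)
      (Measure.pi fun _ => μ) := fun p q => integrable_meanDev_sq μ hn (hm2 p q) (hb2 p q)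
  set Q1 : (Fin n → Z) → ℝ := fun S => ∑ p, meanDev μ (fun z => a z * ψ z p) S ^ 2 with hQ1
  set Q2 : (Fin n → Z) → ℝ := fun S => ∑ p, ∑ q, meanDev μ (fun z => ψ z p * ψ z q) S ^ 2 with hQ2
  have hQ1I : Integrable Q1 (Measure.pi fun _ => μ) := integrable_finsetSum _ fun p _ => hQ1i p
  have hQ2I : Integrable Q2 (Measure.pi fun _ => μ) :=
    integrable_finsetSum _ fun p _ => integrable_finsetSum _ fun q _ => hQ2i p q
  have hprob : ∀ {f : Z → ℝ} {K : ℝ}, Integrable f μ → (∀ᵐ z ∂μ, f z ≤ K) → ∫ z, f z ∂μ ≤ K := by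
    intro f K hf hK
    simpa using integral_mono_ae hf (integrable_const K) hK
  have hsq1 : ∀ p, Integrable (fun z => (a z * ψ z p) ^ 2) μ := fun p =>
    Integrable.of_bound ((hm1 p).pow_const 2).aestronglyMeasurable ((Real.sqrt α * G) ^ 2)
      ((hb1 p).mono fun z hz => by
        rw [Real.norm_eq_abs, abs_pow]; exact pow_le_pow_left₀ (abs_nonneg _) hz 2)
  have hsq2 : ∀ p q, Integrable (fun z => (ψ z p * ψ z q) ^ 2) μ := fun p q =>
    Integrable.of_bound ((hm2 p q).pow_const 2).aestronglyMeasurable ((G * G) ^ 2)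
      ((hb2 p q).mono fun z hz => by
        rw [Real.norm_eq_abs, abs_pow]; exact pow_le_pow_left₀ (abs_nonneg _) hz 2)
  have hQ1le : ∫ S, Q1 S ∂(Measure.pi fun _ => μ) ≤ α * G ^ 2 / n := by
    rw [hQ1, integral_finsetSum _ fun p _ => hQ1i p]
    calc _ ≤ ∑ p, (∫ z, (a z * ψ z p) ^ 2 ∂μ) / n :=
          Finset.sum_le_sum fun p _ => integral_meanDev_sq_le μ hn (hm1 p) (hb1 p)
      _ = (∫ z, ∑ p, (a z * ψ z p) ^ 2 ∂μ) / n := by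
          rw [← Finset.sum_div, integral_finsetSum _ fun p _ => hsq1 p]
      _ ≤ _ := by
          gcongr
          refine hprob (integrable_finsetSum _ fun p _ => hsq1 p) ?_
          filter_upwards [hα, hG] with z h1 h2
          have h3 : ∑ p, (a z * ψ z p) ^ 2 = a z ^ 2 * ‖ψ z‖ ^ 2 := by
            rw [hnorm, Finset.mul_sum]
            exact Finset.sum_congr rfl fun p _ => mul_pow _ _ _
          rw [h3]
          exact mul_le_mul h1 (pow_le_pow_left₀ (norm_nonneg _) h2 2) (sq_nonneg _)
            ((sq_nonneg _).trans h1)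
  have hQ2le : ∫ S, Q2 S ∂(Measure.pi fun _ => μ) ≤ G ^ 4 / n := by
    rw [hQ2, integral_finsetSum _ fun p _ => integrable_finsetSum _ fun q _ => hQ2i p q]
    calc _ ≤ ∑ p, ∑ q, (∫ z, (ψ z p * ψ z q) ^ 2 ∂μ) / n := by
          refine Finset.sum_le_sum fun p _ => ?_
          rw [integral_finsetSum _ fun q _ => hQ2i p q]
          exact Finset.sum_le_sum fun q _ => integral_meanDev_sq_le μ hn (hm2 p q) (hb2 p q)
      _ = (∫ z, ∑ p, ∑ q, (ψ z p * ψ z q) ^ 2 ∂μ) / n := by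
          rw [integral_finsetSum _ fun p _ => integrable_finsetSum _ fun q _ => hsq2 p q,
            Finset.sum_div]
          refine Finset.sum_congr rfl fun p _ => ?_
          rw [integral_finsetSum _ fun q _ => hsq2 p q, Finset.sum_div]
      _ ≤ _ := by
          gcongr
          refine hprob (integrable_finsetSum _ fun p _ => integrable_finsetSum _ fun q _ =>
            hsq2 p q) ?_
          filter_upwards [hG] with z h2
          have h3 : ∑ p, ∑ q, (ψ z p * ψ z q) ^ 2 = ‖ψ z‖ ^ 4 := by
            rw [show ‖ψ z‖ ^ 4 = ‖ψ z‖ ^ 2 * ‖ψ z‖ ^ 2 by ring, hnorm, Finset.sum_mul_sum]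
            exact Finset.sum_congr rfl fun p _ => Finset.sum_congr rfl fun q _ => mul_pow _ _ _
          rw [h3]
          exact pow_le_pow_left₀ (norm_nonneg _) h2 4
  have hD0 : Integrable (meanDev (n := n) μ fun z => a z ^ 2) (Measure.pi fun _ => μ) :=
    integrable_meanDev μ hn hm0 hb0
  have hE1 : Integrable (fun S : Fin n → Z => 1 / 2 * meanDev μ (fun z => a z ^ 2) S)
      (Measure.pi fun _ => μ) := hD0.const_mul _
  have hE2 : Integrable (fun S => c / 2 * R ^ 2 * Q1 S) (Measure.pi fun _ => μ) :=
    hQ1I.const_mul _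
  have hE3 : Integrable (fun S => c' / 4 * R ^ 4 * Q2 S) (Measure.pi fun _ => μ) :=
    hQ2I.const_mul _
  have hE12 : Integrable (fun S : Fin n → Z => 1 / 2 * meanDev μ (fun z => a z ^ 2) S
      + c / 2 * R ^ 2 * Q1 S) (Measure.pi fun _ => μ) := hE1.add hE2
  have hE123 : Integrable (fun S : Fin n → Z => 1 / 2 * meanDev μ (fun z => a z ^ 2) S
      + c / 2 * R ^ 2 * Q1 S + c' / 4 * R ^ 4 * Q2 S) (Measure.pi fun _ => μ) := hE12.add hE3
  refine ⟨fun S => 1 / 2 * meanDev μ (fun z => a z ^ 2) S + c / 2 * R ^ 2 * Q1 S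
    + c' / 4 * R ^ 4 * Q2 S + (1 / (2 * c) + 1 / (4 * c')), hE123.add (integrable_const _), ?_, ?_⟩
  · rw [integral_add hE123 (integrable_const _), integral_add hE12 hE3, integral_add hE1 hE2,
      integral_const_mul, integral_const_mul, integral_const_mul,
      integral_meanDev μ hn hm0 hb0, integral_const, probReal_univ, one_smul]
    have h1 := mul_le_mul_of_nonneg_left hQ1le (show 0 ≤ c / 2 * R ^ 2 by positivity)
    have h2 := mul_le_mul_of_nonneg_left hQ2le (show 0 ≤ c' / 4 * R ^ 4 by positivity)
    linarith
  · intro S v hv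
    have hexp : (fun z => (a z + inner ℝ (ψ z) v) ^ 2 / 2)
        = fun z => (1 / 2 * a z ^ 2 + ∑ p, v p * (a z * ψ z p))
          + 1 / 2 * ∑ p, ∑ q, v p * v q * (ψ z p * ψ z q) := by
      ext z
      have h1 : inner ℝ (ψ z) v = ∑ p, v p * ψ z p := by
        simp [PiLp.inner_apply]
      have h2 : ∑ p, v p * (a z * ψ z p) = a z * ∑ p, v p * ψ z p := by
        rw [Finset.mul_sum]
        exact Finset.sum_congr rfl fun p _ => by ring
      have h3 : ∑ p, ∑ q, v p * v q * (ψ z p * ψ z q) = (∑ p, v p * ψ z p) ^ 2 := by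
        rw [sq, Finset.sum_mul_sum]
        exact Finset.sum_congr rfl fun p _ => Finset.sum_congr rfl fun q _ => by ring
      rw [h1, h2, h3]
      ring
    have hdev : meanDev μ (fun z => (a z + inner ℝ (ψ z) v) ^ 2 / 2) S
        = 1 / 2 * meanDev μ (fun z => a z ^ 2) S
          + ∑ p, v p * meanDev μ (fun z => a z * ψ z p) S
          + 1 / 2 * ∑ p, ∑ q, v p * v q * meanDev μ (fun z => ψ z p * ψ z q) S := by
      have hj1 : ∀ p, Integrable (fun z => v p * (a z * ψ z p)) μ := fun p => (hi1 p).const_mul _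
      have hj2 : ∀ p q, Integrable (fun z => v p * v q * (ψ z p * ψ z q)) μ := fun p q =>
        (hi2 p q).const_mul _
      have hj3 : ∀ p, Integrable (fun z => ∑ q, v p * v q * (ψ z p * ψ z q)) μ := fun p =>
        integrable_finsetSum _ fun q _ => hj2 p q
      have hj0 : Integrable (fun z => 1 / 2 * a z ^ 2) μ := hi0.const_mul _
      have hj4 : Integrable (fun z => ∑ p, v p * (a z * ψ z p)) μ :=
        integrable_finsetSum _ fun p _ => hj1 p
      have hj5 : Integrable (fun z => 1 / 2 * a z ^ 2 + ∑ p, v p * (a z * ψ z p)) μ :=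
        hj0.add hj4
      rw [hexp, meanDev_add μ hj5 ((integrable_finsetSum _ fun p _ => hj3 p).const_mul _),
        meanDev_add μ hj0 hj4, meanDev_const_mul, meanDev_const_mul, meanDev_sum μ _ hj1,
        meanDev_sum μ _ hj3]
      simp only [meanDev_sum μ _ (hj2 _), meanDev_const_mul]
    have hamgm : ∀ {x r : ℝ}, 0 < r → x ≤ r / 2 * x ^ 2 + 1 / (2 * r) := by
      intro x r hr
      have h1 : r / 2 * x ^ 2 + 1 / (2 * r) - x = (r * x - 1) ^ 2 / (2 * r) := by
        field_simp; ring
      have h2 : 0 ≤ (r * x - 1) ^ 2 / (2 * r) := by positivity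
      linarith
    have hv2 : ∑ p, v p ^ 2 ≤ R ^ 2 := by
      rw [← hnorm]; exact pow_le_pow_left₀ (norm_nonneg _) hv 2
    have hl1 : (∑ p, v p * meanDev μ (fun z => a z * ψ z p) S) ^ 2 ≤ R ^ 2 * Q1 S := by
      refine (Finset.sum_mul_sq_le_sq_mul_sq _ _ _).trans ?_
      exact mul_le_mul_of_nonneg_right hv2 (Finset.sum_nonneg fun p _ => sq_nonneg _)
    have hl2 : (∑ p, ∑ q, v p * v q * meanDev μ (fun z => ψ z p * ψ z q) S) ^ 2
        ≤ R ^ 4 * Q2 S := by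
      have h1 : ∑ p, ∑ q, v p * v q * meanDev μ (fun z => ψ z p * ψ z q) S
          = ∑ x : ι × ι, (v x.1 * v x.2) * meanDev μ (fun z => ψ z x.1 * ψ z x.2) S := by
        rw [Fintype.sum_prod_type]
      have h2 : Q2 S = ∑ x : ι × ι, meanDev μ (fun z => ψ z x.1 * ψ z x.2) S ^ 2 := by
        rw [Fintype.sum_prod_type]
      have h3 : ∑ x : ι × ι, (v x.1 * v x.2) ^ 2 ≤ R ^ 4 := by
        rw [Fintype.sum_prod_type]
        simp only [mul_pow]
        rw [← Finset.sum_mul_sum]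
        calc _ ≤ R ^ 2 * R ^ 2 := mul_le_mul hv2 hv2
              (Finset.sum_nonneg fun p _ => sq_nonneg _) (sq_nonneg _)
          _ = _ := by ring
      rw [h1, h2]
      refine (Finset.sum_mul_sq_le_sq_mul_sq _ _ _).trans ?_
      exact mul_le_mul_of_nonneg_right h3 (Finset.sum_nonneg fun p _ => sq_nonneg _)
    have hk1 := hamgm (x := ∑ p, v p * meanDev μ (fun z => a z * ψ z p) S) hc
    have hk2 := hamgm
      (x := ∑ p, ∑ q, v p * v q * meanDev μ (fun z => ψ z p * ψ z q) S) hc'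
    have hk3 := mul_le_mul_of_nonneg_left hl1 (show 0 ≤ c / 2 by positivity)
    have hk4 := mul_le_mul_of_nonneg_left hl2 (show 0 ≤ c' / 4 by positivity)
    have hk5 : 1 / (2 * c') = 2 * (1 / (4 * c')) := by field_simp; norm_num
    rw [← sub_le_iff_le_add']
    change meanDev μ (fun z => (a z + inner ℝ (ψ z) v) ^ 2 / 2) S ≤ _
    rw [hdev]
    linarith

end Deviation

section NetworkRuns

variable {d m n : ℕ} {φ : ℝ → ℝ} {u : Fin m → ℝ}

/-- The residuals `W ↦ f_W(xᵢ) - yᵢ` on a sample. -/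
noncomputable def sampleResidual (φ : ℝ → ℝ) (u : Fin m → ℝ) (S : Fin n → Input d × ℝ)
    (i : Fin n) (W : Param d m) : ℝ := nnet φ u W (S i).1 - (S i).2

/-- The gradients of the residuals on a sample. -/
noncomputable def sampleGrad (φ : ℝ → ℝ) (u : Fin m → ℝ) (S : Fin n → Input d × ℝ)
    (i : Fin n) (W : Param d m) : Param d m := netGrad φ u W (S i).1

theorem gradient_empRisk (hφ : Differentiable ℝ φ) (S : Fin n → Input d × ℝ) (W : Param d m) :
    gradient (empRisk φ u S) W = avgGrad (sampleResidual φ u S) (sampleGrad φ u S) W := by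
  refine HasGradientAt.gradient ?_
  rw [hasGradientAt_iff_hasFDerivAt]
  have h1 : ∀ i, HasFDerivAt (fun W : Param d m => sqLoss φ u W (S i))
      (sampleResidual φ u S i W • InnerProductSpace.toDual ℝ _ (sampleGrad φ u S i W)) W := by
    intro i
    have h2 : HasFDerivAt (fun W : Param d m => nnet φ u W (S i).1 - (S i).2)
        (InnerProductSpace.toDual ℝ _ (sampleGrad φ u S i W)) W :=
      (hasGradientAt_nnet hφ W (S i).1).hasFDerivAt.sub_const _
    have h3 := (h2.mul h2).const_mul (1 / 2 : ℝ)
    refine (h3.congr_fderiv ?_).congr_of_eventuallyEq (Filter.Eventually.of_forall fun W => ?_)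
    · ext D
      simp [sampleResidual]
      ring
    · simp [sqLoss]
      ring
  have h4 := (HasFDerivAt.fun_sum (u := Finset.univ) fun i _ => h1 i).const_mul ((n : ℝ)⁻¹)
  refine (h4.congr_fderiv (ContinuousLinearMap.ext fun D => ?_)).congr_of_eventuallyEq
    (Filter.Eventually.of_forall fun W => ?_)
  · simp [inner_avgGrad, inv_mul_eq_div]
  · simp only [empRisk]
    rw [div_eq_inv_mul]

theorem continuous_nnet_comp {Y : Type*} [TopologicalSpace Y] (hφ : Continuous φ)
    {f : Y → Param d m} {x : Y → Input d} (hf : Continuous f) (hx : Continuous x) :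
    Continuous fun y => nnet φ u (f y) (x y) := by
  unfold nnet
  fun_prop

theorem continuous_netGrad_comp {Y : Type*} [TopologicalSpace Y] (hφ' : Continuous (deriv φ))
    {f : Y → Param d m} {x : Y → Input d} (hf : Continuous f) (hx : Continuous x) :
    Continuous fun y => netGrad φ u (f y) (x y) := by
  unfold netGrad
  refine (PiLp.continuous_toLp 2 _).comp (continuous_pi fun q => ?_)
  fun_prop

theorem continuous_sqLoss_comp {Y : Type*} [TopologicalSpace Y] (hφ : Continuous φ)
    {f : Y → Param d m} {z : Y → Input d × ℝ} (hf : Continuous f) (hz : Continuous z) :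
    Continuous fun y => sqLoss φ u (f y) (z y) := by
  unfold sqLoss
  exact (((continuous_nnet_comp hφ hf hz.fst).sub hz.snd).pow 2).div_const 2

theorem continuous_empRisk (hφ : Continuous φ) (W : Param d m) :
    Continuous fun S : Fin n → Input d × ℝ => empRisk φ u S W := by
  unfold empRisk
  refine Continuous.div_const (continuous_finsetSum _ fun i _ => ?_) _
  exact continuous_sqLoss_comp hφ continuous_const (continuous_apply i)

theorem continuous_gdIter (hφ : Differentiable ℝ φ) (hφ' : Continuous (deriv φ)) (η : ℝ)
    (W0 : Param d m) (t : ℕ) :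
    Continuous fun S : Fin n → Input d × ℝ => gdIter η (empRisk φ u S) W0 t := by
  induction t with
  | zero => exact continuous_const
  | succ t ih =>
    simp only [gdIter, gradient_empRisk hφ]
    have h1 : Continuous fun S : Fin n → Input d × ℝ =>
        avgGrad (sampleResidual φ u S) (sampleGrad φ u S) (gdIter η (empRisk φ u S) W0 t) := by
      have h2 : ∀ i : Fin n, Continuous fun S : Fin n → Input d × ℝ =>
          sampleResidual φ u S i (gdIter η (empRisk φ u S) W0 t)
            • sampleGrad φ u S i (gdIter η (empRisk φ u S) W0 t) := fun i => by
        have hz : Continuous fun S : Fin n → Input d × ℝ => S i := continuous_apply i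
        exact ((continuous_nnet_comp hφ.continuous ih hz.fst).sub hz.snd).smul
          (continuous_netGrad_comp hφ' ih hz.fst)
      exact (continuous_finsetSum Finset.univ fun i _ => h2 i).const_smul ((n : ℝ)⁻¹)
    exact ih.sub (h1.const_smul η)

theorem measurable_sqLoss_gdIter (hφ : Differentiable ℝ φ) (hφ' : Continuous (deriv φ)) (η : ℝ)
    (W0 : Param d m) (t : ℕ) :
    Measurable fun p : (Fin n → Input d × ℝ) × (Input d × ℝ) =>
      sqLoss φ u (gdIter η (empRisk φ u p.1) W0 t) p.2 :=
  (continuous_sqLoss_comp hφ.continuous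
    ((continuous_gdIter hφ hφ' η W0 t).comp continuous_fst) continuous_snd).measurable

theorem measurable_sqLoss (hφ : Differentiable ℝ φ) (W : Param d m) :
    Measurable (sqLoss φ u W) :=
  (continuous_sqLoss_comp hφ.continuous continuous_const continuous_id).measurable

/-- A data point at which the residual is smooth, with initial loss at most `C` and all losses
at most `K`. -/
structure GoodPoint (φ : ℝ → ℝ) (u : Fin m → ℝ) (W0 : Param d m) (G κ ρ C K : ℝ)
    (z : Input d × ℝ) : Prop where
  residual : SmoothResidual G κ ρ (fun W => nnet φ u W z.1 - z.2) (fun W => netGrad φ u W z.1)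
  init_le : sqLoss φ u W0 z ≤ C
  loss_le : ∀ W : Param d m, sqLoss φ u W z ≤ K

variable {W0 : Param d m} {G κ ρ C K η : ℝ}

theorem sqLoss_nonneg (W : Param d m) (z : Input d × ℝ) : 0 ≤ sqLoss φ u W z := by
  unfold sqLoss; positivity

theorem empRisk_nonneg (S : Fin n → Input d × ℝ) (W : Param d m) : 0 ≤ empRisk φ u S W :=
  avgLoss_nonneg (sampleResidual φ u S) W

theorem empRisk_le_of_forall (hn : 0 < n) {S : Fin n → Input d × ℝ} {W : Param d m} {B : ℝ}
    (hS : ∀ i, sqLoss φ u W (S i) ≤ B) : empRisk φ u S W ≤ B := by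
  have hn0 : (0 : ℝ) < n := by exact_mod_cast hn
  unfold empRisk
  rw [div_le_iff₀ hn0]
  calc _ ≤ ∑ _i : Fin n, B := Finset.sum_le_sum fun i _ => hS i
    _ = _ := by simp [mul_comm]

theorem gdRun_of_good (hφ : Differentiable ℝ φ) (hn : 0 < n) (hκ : 0 ≤ κ) (hη0 : 0 < η)
    (hη : η * (2 * ρ) ≤ 1) {S : Fin n → Input d × ℝ}
    (hS : ∀ i, GoodPoint φ u W0 G κ ρ C K (S i)) :
    GDRun G κ ρ η C (sampleResidual φ u S) (sampleGrad φ u S) (gdIter η (empRisk φ u S) W0) where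
  pos := hn
  step_pos := hη0
  step_le := hη
  curv_nonneg := hκ
  residual i := (hS i).residual
  next t := by rw [gdIter, gradient_empRisk hφ]
  init_le := empRisk_le_of_forall hn fun i => (hS i).init_le

variable {μ : Measure (Input d × ℝ)}

theorem popRisk_nonneg (W : Param d m) : 0 ≤ popRisk φ u μ W :=
  integral_nonneg fun z => sqLoss_nonneg W z

variable [IsProbabilityMeasure μ]

theorem measurable_popRisk_gdIter (hφ : Differentiable ℝ φ) (hφ' : Continuous (deriv φ)) (η : ℝ)
    (W0 : Param d m) (t : ℕ) :
    Measurable fun S : Fin n → Input d × ℝ => popRisk φ u μ (gdIter η (empRisk φ u S) W0 t) := by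
  exact ((measurable_sqLoss_gdIter hφ hφ' η W0 t).stronglyMeasurable.integral_prod_right
    (ν := μ)).measurable

theorem integrable_sqLoss (hφ : Differentiable ℝ φ)
    (hgood : ∀ᵐ z ∂μ, GoodPoint φ u W0 G κ ρ C K z) (W : Param d m) :
    Integrable (sqLoss φ u W) μ := by
  refine Integrable.of_bound (measurable_sqLoss hφ W).aestronglyMeasurable K
    (hgood.mono fun z hz => ?_)
  rw [Real.norm_eq_abs, abs_of_nonneg (sqLoss_nonneg W z)]
  exact hz.loss_le W

theorem popRisk_le_of_ae (hφ : Differentiable ℝ φ)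
    (hgood : ∀ᵐ z ∂μ, GoodPoint φ u W0 G κ ρ C K z) (W : Param d m) {q : Input d × ℝ → ℝ}
    (hq : Integrable q μ) (h : ∀ᵐ z ∂μ, sqLoss φ u W z ≤ q z) : popRisk φ u μ W ≤ ∫ z, q z ∂μ :=
  integral_mono_ae (integrable_sqLoss hφ hgood W) hq h

theorem integrable_popRisk_gdIter (hφ : Differentiable ℝ φ) (hφ' : Continuous (deriv φ))
    (hgood : ∀ᵐ z ∂μ, GoodPoint φ u W0 G κ ρ C K z) (t : ℕ) :
    Integrable (fun S : Fin n → Input d × ℝ => popRisk φ u μ (gdIter η (empRisk φ u S) W0 t))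
      (Measure.pi fun _ => μ) := by
  refine Integrable.of_bound
    (measurable_popRisk_gdIter hφ hφ' η W0 t).aestronglyMeasurable K
    (Filter.Eventually.of_forall fun S => ?_)
  rw [Real.norm_eq_abs, abs_of_nonneg (popRisk_nonneg _)]
  have := popRisk_le_of_ae hφ hgood (gdIter η (empRisk φ u S) W0 t) (integrable_const K)
    (hgood.mono fun z hz => hz.loss_le _)
  simpa using this

theorem integrable_empRisk_gdIter (hφ : Differentiable ℝ φ) (hφ' : Continuous (deriv φ))
    (hn : 0 < n) (hgood : ∀ᵐ z ∂μ, GoodPoint φ u W0 G κ ρ C K z) (t : ℕ) :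
    Integrable (fun S : Fin n → Input d × ℝ => empRisk φ u S (gdIter η (empRisk φ u S) W0 t))
      (Measure.pi fun _ => μ) := by
  have h : ∀ i : Fin n, Continuous fun S : Fin n → Input d × ℝ =>
      sqLoss φ u (gdIter η (empRisk φ u S) W0 t) (S i) := fun i =>
    continuous_sqLoss_comp hφ.continuous (continuous_gdIter hφ hφ' η W0 t) (continuous_apply i)
  have hc : Continuous fun S : Fin n → Input d × ℝ =>
      empRisk φ u S (gdIter η (empRisk φ u S) W0 t) :=
    (continuous_finsetSum Finset.univ fun i _ => h i).div_const (n : ℝ)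
  refine Integrable.of_bound hc.measurable.aestronglyMeasurable K
    ((ae_pi_forall (ι := Fin n) μ hgood).mono fun S hS => ?_)
  rw [Real.norm_eq_abs, abs_of_nonneg (empRisk_nonneg _ _)]
  exact empRisk_le_of_forall hn fun i => (hS i).loss_le _

/-- The regularized oracle risk on a sample. -/
noncomputable def oracleRisk (φ : ℝ → ℝ) (u : Fin m → ℝ) (W0 : Param d m) (τ a r : ℝ)
    (S : Fin n → Input d × ℝ) : ℝ :=
  ⨅ W : Param d m, (empRisk φ u S W + ‖W - W0‖ ^ 2 / τ + a * (‖W - W0‖ ^ 3 + r))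

variable {τ a r : ℝ}

theorem oracleRisk_bddBelow (hτ : 0 < τ) (ha : 0 ≤ a) (hr : 0 ≤ r) (S : Fin n → Input d × ℝ) :
    BddBelow (Set.range fun W : Param d m =>
      empRisk φ u S W + ‖W - W0‖ ^ 2 / τ + a * (‖W - W0‖ ^ 3 + r)) := by
  refine ⟨0, ?_⟩
  rintro _ ⟨W, rfl⟩
  have := empRisk_nonneg (φ := φ) (u := u) S W
  positivity

theorem le_oracleRisk {S : Fin n → Input d × ℝ} (ha : 0 ≤ a) {b : ℝ}
    (hb : ∀ W, b ≤ empRisk φ u S W + ‖W - W0‖ ^ 2 / τ) : b + a * r ≤ oracleRisk φ u W0 τ a r S := by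
  refine le_ciInf fun W => ?_
  have h1 := hb W
  have h2 : 0 ≤ a * ‖W - W0‖ ^ 3 := by positivity
  linarith

theorem oracleRisk_nonneg (hτ : 0 < τ) (ha : 0 ≤ a) (hr : 0 ≤ r) (S : Fin n → Input d × ℝ) :
    0 ≤ oracleRisk φ u W0 τ a r S :=
  le_ciInf fun W => by
    have := empRisk_nonneg (φ := φ) (u := u) S W
    positivity

theorem integrable_oracleRisk (hφ : Differentiable ℝ φ) (hn : 0 < n)
    (hgood : ∀ᵐ z ∂μ, GoodPoint φ u W0 G κ ρ C K z) (hτ : 0 < τ) (ha : 0 ≤ a) (hr : 0 ≤ r) :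
    Integrable (oracleRisk (n := n) φ u W0 τ a r) (Measure.pi fun _ => μ) := by
  have husc : UpperSemicontinuous (oracleRisk (n := n) φ u W0 τ a r) :=
    upperSemicontinuous_ciInf (oracleRisk_bddBelow hτ ha hr) fun W =>
      (((continuous_empRisk hφ.continuous W).add continuous_const).add
        continuous_const).upperSemicontinuous
  refine Integrable.of_bound husc.measurable.aestronglyMeasurable (C + a * r)
    ((ae_pi_forall (ι := Fin n) μ hgood).mono fun S hS => ?_)
  rw [Real.norm_eq_abs, abs_of_nonneg (oracleRisk_nonneg hτ ha hr S)]
  have h1 : oracleRisk φ u W0 τ a r S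
      ≤ empRisk φ u S W0 + ‖W0 - W0‖ ^ 2 / τ + a * (‖W0 - W0‖ ^ 3 + r) :=
    ciInf_le (oracleRisk_bddBelow hτ ha hr S) W0
  have h2 := empRisk_le_of_forall hn fun i => (hS i).init_le
  simp at h1
  linarith

end NetworkRuns

section RiskBounds

variable {d m n : ℕ} {φ : ℝ → ℝ} {u : Fin m → ℝ} {W0 : Param d m} {G κ ρ C K η τ a r : ℝ}
  {μ : Measure (Input d × ℝ)} [IsProbabilityMeasure μ]

/-- Risk bound through on-average stability, given control of the empirical risks. -/
theorem integral_popRisk_le_of_stable (hφ : Differentiable ℝ φ) (hφ' : Continuous (deriv φ))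
    (hn : 0 < n) (hκ : 0 ≤ κ) (hη0 : 0 < η) (hη : η * (2 * ρ) ≤ 1)
    (hgood : ∀ᵐ z ∂μ, GoodPoint φ u W0 G κ ρ C K z) (hτ : 0 < τ) (ha : 0 ≤ a) (hr : 0 ≤ r)
    {T : ℕ} (hT : 1 ≤ T) {P Λ : ℝ}
    (hP : Real.exp (2 / 9 * (η ^ 2 * κ ^ 2 * C) * T ^ 2 + η * κ * Real.sqrt (2 * C) * T) ≤ P)
    (hopt : ∀ S : Fin n → Input d × ℝ, (∀ i, GoodPoint φ u W0 G κ ρ C K (S i)) →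
      empRisk φ u S (gdIter η (empRisk φ u S) W0 T) ≤ oracleRisk φ u W0 τ a r S ∧
      (∑ t ∈ Finset.range T, empRisk φ u S (gdIter η (empRisk φ u S) W0 t)) / T
        ≤ Λ * oracleRisk φ u W0 τ a r S) :
    ∫ S, popRisk φ u μ (gdIter η (empRisk φ u S) W0 T) ∂(Measure.pi fun _ : Fin n => μ)
      ≤ (1 + P * (1 + 4 * Λ) * (G ^ 2 * (η * T) / n)
          + 4 * Λ * P ^ 2 * (G ^ 2 * (η * T) / n) ^ 2)
        * ∫ S, oracleRisk φ u W0 τ a r S ∂(Measure.pi fun _ : Fin n => μ) := by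
  have hP0 : 0 ≤ P := (Real.exp_pos _).le.trans hP
  have hgoodn := ae_pi_forall (ι := Fin n) μ hgood
  have hΦ := integrable_oracleRisk (n := n) hφ hn hgood hτ ha hr
  set y := G ^ 2 * (η * T) / n with hy
  have hy0 : 0 ≤ y := by positivity
  have hstab := integral_risk_le_of_stability μ hn (T := T)
    (fun t (S : Fin n → Input d × ℝ) z => sqLoss φ u (gdIter η (empRisk φ u S) W0 t) z)
    (fun t => measurable_sqLoss_gdIter hφ hφ' η W0 t) (K := K) (A := P * y)
    (B := 2 * P * y + 2 * P ^ 2 * y ^ 2)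
    (hgood.mono fun z hz t S => by
      rw [abs_of_nonneg (sqLoss_nonneg _ z)]; exact hz.loss_le _)
    (by
      filter_upwards [ae_pi_forall (ι := Fin (n + 1)) μ hgood] with ω hω i
      have R := gdRun_of_good (S := Fin.tail ω) hφ hn hκ hη0 hη fun j => hω j.succ
      have R' := gdRun_of_good (S := Fin.tail (swapHead i ω)) hφ hn hκ hη0 hη fun j => hω _
      have hne : ∀ j : Fin n, j ≠ i →
          (Fin.tail (swapHead i ω) : Fin n → Input d × ℝ) j = (Fin.tail ω : Fin n → _) j := by
        intro j hj
        simp only [Fin.tail, swapHead, Function.comp_apply]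
        rw [Equiv.swap_apply_of_ne_of_ne (Fin.succ_ne_zero j)
          (fun h => hj (Fin.succ_injective n h))]
      have heq : (Fin.tail (swapHead i ω) : Fin n → Input d × ℝ) i = ω 0 := by
        simp [Fin.tail, swapHead]
      have h := R.half_sq_sub_le R' rfl i
        (fun j hj => by funext W; simp only [sampleResidual, hne j hj])
        (fun j hj => by funext W; simp only [sampleGrad, hne j hj]) hT hP
      simp only [sampleResidual, heq] at h
      simp only [sqLoss]
      rw [← hy] at h
      refine h.trans (le_of_eq ?_)
      simp only [Fin.tail]
      ring)
  have hmeasE : ∀ t, Integrable (fun S : Fin n → Input d × ℝ =>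
      empRisk φ u S (gdIter η (empRisk φ u S) W0 t)) (Measure.pi fun _ => μ) := fun t =>
    integrable_empRisk_gdIter hφ hφ' hn hgood t
  have h1 : ∫ S, empRisk φ u S (gdIter η (empRisk φ u S) W0 T) ∂(Measure.pi fun _ : Fin n => μ)
      ≤ ∫ S, oracleRisk φ u W0 τ a r S ∂(Measure.pi fun _ : Fin n => μ) :=
    integral_mono_ae (hmeasE T) hΦ (hgoodn.mono fun S hS => (hopt S hS).1)
  have h2 : ∫ S, (∑ t ∈ Finset.range T, empRisk φ u S (gdIter η (empRisk φ u S) W0 t)) / T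
        ∂(Measure.pi fun _ : Fin n => μ)
      ≤ Λ * ∫ S, oracleRisk φ u W0 τ a r S ∂(Measure.pi fun _ : Fin n => μ) := by
    rw [← integral_const_mul]
    exact integral_mono_ae ((integrable_finsetSum _ fun t _ => hmeasE t).div_const _)
      (hΦ.const_mul _) (hgoodn.mono fun S hS => (hopt S hS).2)
  refine hstab.trans ?_
  have h3 := mul_le_mul_of_nonneg_left h1 (show 0 ≤ 1 + P * y by positivity)
  have h4 := mul_le_mul_of_nonneg_left h2
    (show 0 ≤ 2 * (2 * P * y + 2 * P ^ 2 * y ^ 2) by positivity)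
  refine (add_le_add h3 h4).trans (le_of_eq ?_)
  ring

theorem popRisk_init_le (hφ : Differentiable ℝ φ)
    (hgood : ∀ᵐ z ∂μ, GoodPoint φ u W0 G κ ρ C K z) : popRisk φ u μ W0 ≤ C := by
  simpa using popRisk_le_of_ae hφ hgood W0 (integrable_const C) (hgood.mono fun z hz => hz.init_le)

/-- Crude risk bound from the distance travelled. -/
theorem integral_popRisk_le_init (hφ : Differentiable ℝ φ) (hφ' : Continuous (deriv φ))
    (hn : 0 < n) (hκ : 0 ≤ κ) (hη0 : 0 < η) (hη : η * (2 * ρ) ≤ 1) (hC : 0 ≤ C)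
    (hgood : ∀ᵐ z ∂μ, GoodPoint φ u W0 G κ ρ C K z) {T : ℕ} {s : ℝ} (hs : 0 ≤ s)
    (hs2 : s ^ 2 = G ^ 2 * (η * T)) :
    ∫ S, popRisk φ u μ (gdIter η (empRisk φ u S) W0 T) ∂(Measure.pi fun _ : Fin n => μ)
      ≤ popRisk φ u μ W0 + (817 / 500 * s + 2 / 3 * s ^ 2) * C := by
  have h1 : ∀ᵐ S ∂(Measure.pi fun _ : Fin n => μ),
      popRisk φ u μ (gdIter η (empRisk φ u S) W0 T)
        ≤ popRisk φ u μ W0 + (817 / 500 * s + 2 / 3 * s ^ 2) * C := by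
    filter_upwards [ae_pi_forall (ι := Fin n) μ hgood] with S hS
    have R := gdRun_of_good hφ hn hκ hη0 hη hS
    have hd := R.norm_sub_sq_le' T
    change ‖gdIter η (empRisk φ u S) W0 T - W0‖ ^ 2 ≤ _ at hd
    set V := gdIter η (empRisk φ u S) W0 T
    have hG := R.lipschitz_nonneg
    have hpt : ∀ᵐ z ∂μ, sqLoss φ u V z
        ≤ sqLoss φ u W0 z + (817 / 500 * s + 2 / 3 * s ^ 2) * C := by
      filter_upwards [hgood] with z hz
      have hlip := hz.residual.abs_sub_le W0 V
      have h0 := hz.init_le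
      unfold sqLoss at h0 ⊢
      set x := nnet φ u W0 z.1 - z.2
      set x' := nnet φ u V z.1 - z.2
      have hδ2 : (G * ‖V - W0‖) ^ 2 ≤ 4 / 3 * s ^ 2 * C := by
        rw [mul_pow, hs2]
        nlinarith [mul_le_mul_of_nonneg_left hd (sq_nonneg G)]
      have hcross : x * (x' - x) ≤ 817 / 500 * s * C := by
        refine abs_le_of_sq_le_sq' ?_ (by positivity) |>.2
        have h2 := pow_le_pow_left₀ (abs_nonneg _) hlip 2
        rw [sq_abs] at h2
        have h3 : x ^ 2 ≤ 2 * C := by linarith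
        rw [mul_pow]
        calc _ ≤ 2 * C * (4 / 3 * s ^ 2 * C) :=
              mul_le_mul h3 (h2.trans hδ2) (sq_nonneg _) (by positivity)
          _ ≤ _ := by nlinarith [mul_nonneg (sq_nonneg s) (sq_nonneg C)]
      have h4 := pow_le_pow_left₀ (abs_nonneg _) hlip 2
      rw [sq_abs] at h4
      nlinarith
    have := popRisk_le_of_ae hφ hgood V
      ((integrable_sqLoss hφ hgood W0).add (integrable_const _)) hpt
    rw [integral_add' (integrable_sqLoss hφ hgood W0) (integrable_const _)] at this
    simpa [popRisk] using this
  simpa using integral_mono_ae (integrable_popRisk_gdIter hφ hφ' hgood T) (integrable_const _) h1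

theorem le_integral_oracleRisk (hφ : Differentiable ℝ φ) (hn : 0 < n)
    (hgood : ∀ᵐ z ∂μ, GoodPoint φ u W0 G κ ρ C K z) (hτ : 0 < τ) (ha : 0 ≤ a) (hr : 0 ≤ r) :
    a * r ≤ ∫ S, oracleRisk φ u W0 τ a r S ∂(Measure.pi fun _ : Fin n => μ) := by
  have h := integral_mono (μ := Measure.pi fun _ : Fin n => μ) (integrable_const (a * r))
    (integrable_oracleRisk (n := n) hφ hn hgood hτ ha hr) fun S => by
      have := le_oracleRisk (φ := φ) (u := u) (W0 := W0) (S := S) (τ := τ) (r := r) (b := 0) ha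
        fun W => by
          have := empRisk_nonneg (φ := φ) (u := u) S W
          positivity
      linarith
  simpa using h

theorem le_integral_oracleRisk_init (hφ : Differentiable ℝ φ) (hn : 0 < n)
    (hgood : ∀ᵐ z ∂μ, GoodPoint φ u W0 G κ ρ C K z) (hτ : 0 < τ) (ha : 0 ≤ a) (hr : 0 ≤ r) :
    popRisk φ u μ W0 - G ^ 2 * τ / 2 * C + a * r
      ≤ ∫ S, oracleRisk φ u W0 τ a r S ∂(Measure.pi fun _ : Fin n => μ) := by
  have hbd : ∀ᵐ z ∂μ, |sqLoss φ u W0 z| ≤ K := hgood.mono fun z hz => by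
    rw [abs_of_nonneg (sqLoss_nonneg _ z)]; exact hz.loss_le _
  have he := integral_empirical_mean (n := n) μ hn (measurable_sqLoss hφ W0) hbd
  have hi : Integrable (fun S : Fin n → Input d × ℝ => (∑ i, sqLoss φ u W0 (S i)) / (n : ℝ))
      (Measure.pi fun _ => μ) :=
    (integrable_finsetSum _ fun i _ => Integrable.of_bound
      ((measurable_sqLoss hφ W0).comp (measurable_pi_apply i)).aestronglyMeasurable K
      ((ae_pi_forall (ι := Fin n) μ hbd).mono fun S hS => hS i)).div_const _
  have h := integral_mono_ae (hi.add (integrable_const (-(G ^ 2 * τ / 2 * C) + a * r)))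
    (integrable_oracleRisk (n := n) hφ hn hgood hτ ha hr)
    ((ae_pi_forall (ι := Fin n) μ hgood).mono fun S hS => by
      have h1 := le_oracleRisk (φ := φ) (u := u) (W0 := W0) (S := S) (τ := τ) (r := r) ha
        fun W => avgLoss_mul_le hn (fun i => (hS i).residual) W0 W hτ
      have h2 : empRisk φ u S W0 ≤ C := empRisk_le_of_forall hn fun i => (hS i).init_le
      have h3 := mul_le_mul_of_nonneg_right h2 (show 0 ≤ G ^ 2 * τ / 2 by positivity)
      change empRisk φ u S W0 + (-(G ^ 2 * τ / 2 * C) + a * r) ≤ _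
      change empRisk φ u S W0 * (1 - G ^ 2 * τ / 2) + a * r ≤ _ at h1
      linarith)
  rw [integral_add' hi (integrable_const _), he] at h
  simp only [integral_const, probReal_univ, one_smul] at h
  unfold popRisk
  linarith

/-- Risk bound through linearization at the initialization and uniform deviations. -/
theorem integral_popRisk_le_linearized (hφ : Differentiable ℝ φ) (hφ' : Continuous (deriv φ))
    (hn : 0 < n) (hκ : 0 ≤ κ) (hη0 : 0 < η) (hη : η * (2 * ρ) ≤ 1) (hC : 0 < C)
    (hgood : ∀ᵐ z ∂μ, GoodPoint φ u W0 G κ ρ C K z) {T : ℕ} {s : ℝ} (hs : 0 < s)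
    (hs2 : s ^ 2 = G ^ 2 * (η * T)) :
    ∫ S, popRisk φ u μ (gdIter η (empRisk φ u S) W0 T) ∂(Measure.pi fun _ : Fin n => μ)
      ≤ (4 + 4 / 3 * (κ * (η * T)) ^ 2 * C + 1 / 10 + s / 20
          + (80 / 3 * s ^ 2 + 80 / 9 * s ^ 3) / n) * C := by
  have hn0 : (0 : ℝ) < n := by exact_mod_cast hn
  set t := η * (T : ℝ) with ht
  have ht0 : 0 ≤ t := by positivity
  set R := Real.sqrt (4 / 3 * t * C) with hR
  have hR2 : R ^ 2 = 4 / 3 * t * C := Real.sq_sqrt (by positivity)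
  set e := κ / 2 * R ^ 2 with he
  have he0 : 0 ≤ e := by positivity
  have hma : Measurable fun z : Input d × ℝ => nnet φ u W0 z.1 - z.2 :=
    ((continuous_nnet_comp hφ.continuous continuous_const continuous_fst).sub
      continuous_snd).measurable
  have hmψ : Measurable fun z : Input d × ℝ => netGrad φ u W0 z.1 :=
    (continuous_netGrad_comp hφ' continuous_const continuous_fst).measurable
  obtain ⟨U, hUi, hUle, hU⟩ := exists_uniform_quadratic_deviation (n := n) μ hn hma hmψ
    (α := 2 * C) (G := G) (R := R) (c := 10 / C) (c' := 10 / (s * C))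
    (hgood.mono fun z hz => by have := hz.init_le; unfold sqLoss at this; linarith)
    (hgood.mono fun z hz => hz.residual.norm_grad_le W0) (by positivity) (by positivity)
  have hpt : ∀ᵐ S ∂(Measure.pi fun _ : Fin n => μ),
      popRisk φ u μ (gdIter η (empRisk φ u S) W0 T) ≤ 4 * C + 3 * e ^ 2 + 2 * U S := by
    filter_upwards [ae_pi_forall (ι := Fin n) μ hgood] with S hS
    have run := gdRun_of_good hφ hn hκ hη0 hη hS
    have hd := run.norm_sub_sq_le' T
    have hL : empRisk φ u S (gdIter η (empRisk φ u S) W0 T) ≤ C := run.avgLoss_le T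
    change ‖gdIter η (empRisk φ u S) W0 T - W0‖ ^ 2 ≤ _ at hd
    set V := gdIter η (empRisk φ u S) W0 T
    have hv : ‖V - W0‖ ≤ R := Real.le_sqrt_of_sq_le hd
    have hrem : ∀ z, GoodPoint φ u W0 G κ ρ C K z →
        (nnet φ u V z.1 - z.2
          - (nnet φ u W0 z.1 - z.2 + inner ℝ (netGrad φ u W0 z.1) (V - W0))) ^ 2 ≤ e ^ 2 := by
      intro z hz
      have h1 := hz.residual.abs_taylor_le W0 V
      have h2 : |nnet φ u V z.1 - z.2
          - (nnet φ u W0 z.1 - z.2 + inner ℝ (netGrad φ u W0 z.1) (V - W0))| ≤ e := by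
        rw [← sub_sub]
        refine h1.trans ?_
        rw [he]
        gcongr
      exact sq_le_sq' (abs_le.1 h2).1 (abs_le.1 h2).2
    have hlin : ∀ z, GoodPoint φ u W0 G κ ρ C K z →
        (nnet φ u W0 z.1 - z.2 + inner ℝ (netGrad φ u W0 z.1) (V - W0)) ^ 2 / 2
          ≤ 2 * sqLoss φ u V z + e ^ 2 := by
      intro z hz
      have h1 := hrem z hz
      unfold sqLoss
      nlinarith [sq_nonneg (nnet φ u V z.1 - z.2 + (nnet φ u V z.1 - z.2
          - (nnet φ u W0 z.1 - z.2 + inner ℝ (netGrad φ u W0 z.1) (V - W0))))]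
    have hli : Integrable (fun z : Input d × ℝ =>
        (nnet φ u W0 z.1 - z.2 + inner ℝ (netGrad φ u W0 z.1) (V - W0)) ^ 2 / 2) μ := by
      have hm : Measurable fun z : Input d × ℝ =>
          (nnet φ u W0 z.1 - z.2 + inner ℝ (netGrad φ u W0 z.1) (V - W0)) ^ 2 / 2 :=
        ((hma.add (hmψ.inner measurable_const)).pow_const 2).div_const 2
      refine Integrable.of_bound hm.aestronglyMeasurable (2 * K + e ^ 2)
        (hgood.mono fun z hz => ?_)
      rw [Real.norm_eq_abs, abs_of_nonneg (by positivity)]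
      linarith [hlin z hz, hz.loss_le V]
    have h1 : popRisk φ u μ V ≤ ∫ z, (2 * ((nnet φ u W0 z.1 - z.2
        + inner ℝ (netGrad φ u W0 z.1) (V - W0)) ^ 2 / 2) + e ^ 2) ∂μ := by
      refine popRisk_le_of_ae hφ hgood V ((hli.const_mul 2).add (integrable_const _))
        (hgood.mono fun z hz => ?_)
      have h2 := hrem z hz
      unfold sqLoss
      nlinarith [sq_nonneg (nnet φ u V z.1 - z.2
          - 2 * (nnet φ u W0 z.1 - z.2 + inner ℝ (netGrad φ u W0 z.1) (V - W0)))]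
    rw [integral_add (hli.const_mul 2) (integrable_const _), integral_const_mul, integral_const,
      probReal_univ, one_smul] at h1
    have h3 := hU S (V - W0) hv
    have h4 : (∑ i, (nnet φ u W0 (S i).1 - (S i).2
        + inner ℝ (netGrad φ u W0 (S i).1) (V - W0)) ^ 2 / 2) / (n : ℝ)
        ≤ 2 * empRisk φ u S V + e ^ 2 := by
      rw [div_le_iff₀ hn0]
      calc _ ≤ ∑ i, (2 * sqLoss φ u V (S i) + e ^ 2) :=
            Finset.sum_le_sum fun i _ => hlin (S i) (hS i)
        _ = _ := by
          rw [Finset.sum_add_distrib, ← Finset.mul_sum]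
          unfold empRisk
          simp
          field_simp
    linarith
  have hint := integral_mono_ae (integrable_popRisk_gdIter hφ hφ' hgood T)
    ((integrable_const (4 * C + 3 * e ^ 2)).add (hUi.const_mul 2)) hpt
  rw [integral_add' (integrable_const _) (hUi.const_mul 2), integral_const_mul, integral_const,
    probReal_univ, one_smul] at hint
  have hbound : 10 / C / 2 * R ^ 2 * (2 * C * G ^ 2 / n) + 1 / (2 * (10 / C))
      + 10 / (s * C) / 4 * R ^ 4 * (G ^ 4 / n) + 1 / (4 * (10 / (s * C)))
      = (40 / 3 * s ^ 2 / n + 1 / 20 + 40 / 9 * s ^ 3 / n + s / 40) * C := by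
    have h4 : R ^ 4 * G ^ 4 = 16 / 9 * C ^ 2 * s ^ 4 := by
      calc R ^ 4 * G ^ 4 = (R ^ 2) ^ 2 * (G ^ 2) ^ 2 := by ring
        _ = 16 / 9 * C ^ 2 * (G ^ 2 * t) ^ 2 := by rw [hR2]; ring
        _ = _ := by rw [← hs2]; ring
    have h5 : 10 / (s * C) / 4 * R ^ 4 * (G ^ 4 / n)
        = 10 / (s * C) / 4 * (R ^ 4 * G ^ 4) / n := by ring
    have h6 : 10 / C / 2 * R ^ 2 * (2 * C * G ^ 2 / n)
        = 10 / C / 2 * (8 / 3 * C ^ 2 * (G ^ 2 * t)) / n := by rw [hR2]; ring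
    rw [h5, h6, h4, ← hs2]
    field_simp
    ring
  rw [hbound] at hUle
  have he2 : 3 * e ^ 2 = 4 / 3 * (κ * t) ^ 2 * C * C := by rw [he, hR2]; ring
  calc _ ≤ _ := hint
    _ ≤ 4 * C + 4 / 3 * (κ * t) ^ 2 * C * C
        + 2 * ((40 / 3 * s ^ 2 / n + 1 / 20 + 40 / 9 * s ^ 3 / n + s / 40) * C) := by
      rw [he2]; linarith
    _ = _ := by ring

end RiskBounds

section Oracle

variable {d m n : ℕ} {φ : ℝ → ℝ} {u : Fin m → ℝ} {W0 : Param d m} {G κ ρ C K η a r : ℝ}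
  {μ : Measure (Input d × ℝ)} [IsProbabilityMeasure μ] {T : ℕ}

theorem stability_exponent_eq (η κ C : ℝ) (T : ℕ) (hC : 0 ≤ C) :
    2 / 9 * (η ^ 2 * κ ^ 2 * C) * (T : ℝ) ^ 2 + η * κ * Real.sqrt (2 * C) * T
      = 2 / 9 * (κ * (η * T) * Real.sqrt C) ^ 2
        + Real.sqrt 2 * (κ * (η * T) * Real.sqrt C) := by
  rw [Real.sqrt_mul zero_le_two, mul_pow (κ * (η * T)), Real.sq_sqrt hC]
  ring

theorem sqrt_two_lt : Real.sqrt 2 < 1415 / 1000 := by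
  rw [Real.sqrt_lt' (by norm_num)]; norm_num

/-- Small effective curvature: the oracle bound via regret and stability. -/
theorem oracle_bound_of_small_curvature (hφ : Differentiable ℝ φ) (hφ' : Continuous (deriv φ))
    (hn : 0 < n) (hκ : 0 ≤ κ) (hη0 : 0 < η) (hη : η * (2 * ρ) ≤ 1) (hC : 0 < C)
    (hgood : ∀ᵐ z ∂μ, GoodPoint φ u W0 G κ ρ C K z) (ha : 0 ≤ a) (hr : 0 ≤ r) (hT : 1 ≤ T)
    (hX : κ * (η * T) * Real.sqrt C ≤ 2 / 5) :
    ∫ S, popRisk φ u μ (gdIter η (empRisk φ u S) W0 T) ∂(Measure.pi fun _ : Fin n => μ)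
      ≤ (1 + 26 * (G ^ 2 * (η * T) / n) + 48 * (G ^ 2 * (η * T) / n) ^ 2)
        * ∫ S, oracleRisk φ u W0 (η * T) a r S ∂(Measure.pi fun _ : Fin n => μ) := by
  have hT0 : (0 : ℝ) < T := by exact_mod_cast hT
  set X := κ * (η * T) * Real.sqrt C with hXdef
  have hX0 : 0 ≤ X := by positivity
  have h2 := sqrt_two_lt
  have h2' := Real.sqrt_nonneg 2
  have hlog := Real.log_two_gt_d9
  have hexp : ∀ x, x ≤ 0.6931471803 → Real.exp x ≤ 2 := fun x hx => by
    rw [← Real.exp_log (show (0 : ℝ) < 2 by norm_num)]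
    exact Real.exp_le_exp.2 (by linarith)
  have hP : Real.exp (2 / 9 * (η ^ 2 * κ ^ 2 * C) * (T : ℝ) ^ 2
      + η * κ * Real.sqrt (2 * C) * T) ≤ 2 := by
    rw [stability_exponent_eq _ _ _ _ hC.le]
    refine hexp _ ?_
    rw [← hXdef]
    nlinarith
  have hpow : (1 + η * κ * Real.sqrt (2 * C)) ^ T ≤ 2 := by
    have h1 : 1 + η * κ * Real.sqrt (2 * C) ≤ Real.exp (η * κ * Real.sqrt (2 * C)) := by
      linarith [Real.add_one_le_exp (η * κ * Real.sqrt (2 * C))]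
    refine (pow_le_pow_left₀ (by positivity) h1 T).trans ?_
    rw [← Real.exp_nat_mul]
    refine hexp _ ?_
    have h3 : (T : ℝ) * (η * κ * Real.sqrt (2 * C)) = Real.sqrt 2 * X := by
      rw [hXdef, Real.sqrt_mul zero_le_two]; ring
    rw [h3]
    nlinarith
  have har : 0 ≤ a * r := mul_nonneg ha hr
  have h := integral_popRisk_le_of_stable (τ := η * T) (Λ := 3) hφ hφ' hn hκ hη0 hη hgood
    (by positivity) ha hr hT hP fun S hS => by
      have R := gdRun_of_good hφ hn hκ hη0 hη hS
      constructor
      · have := le_oracleRisk (φ := φ) (u := u) (W0 := W0) (S := S) (r := r) ha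
          fun W => (R.optimization hT hpow W).1
        exact (le_add_of_nonneg_right har).trans this
      · have h3 : ∀ W, (∑ t ∈ Finset.range T, empRisk φ u S (gdIter η (empRisk φ u S) W0 t)) / T / 3
            ≤ empRisk φ u S W + ‖W - W0‖ ^ 2 / (η * T) := fun W => by
          rw [div_le_iff₀' (by norm_num : (0 : ℝ) < 3)]
          exact (R.optimization hT hpow W).2
        have := le_oracleRisk (r := r) ha h3
        linarith
  refine h.trans (le_of_eq ?_)
  ring

/-- Moderate effective curvature: the initial loss is already below the oracle risk. -/
theorem oracle_bound_of_moderate_curvature (hφ : Differentiable ℝ φ) (hφ' : Continuous (deriv φ))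
    (hn : 0 < n) (hκ : 0 ≤ κ) (hη0 : 0 < η) (hη : η * (2 * ρ) ≤ 1) (hC : 0 < C)
    (hgood : ∀ᵐ z ∂μ, GoodPoint φ u W0 G κ ρ C K z) (ha : 0 ≤ a) (hr : 0 ≤ r) (hT : 1 ≤ T)
    {s : ℝ} (hs : 0 ≤ s) (hs2 : s ^ 2 = G ^ 2 * (η * T))
    (har : 14 / 5 * (κ * (η * T) * Real.sqrt C) * s * C ≤ a * r)
    (hX : 2 / 5 ≤ κ * (η * T) * Real.sqrt C) (hX' : κ * (η * T) * Real.sqrt C ≤ 5 / 4) :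
    ∫ S, popRisk φ u μ (gdIter η (empRisk φ u S) W0 T) ∂(Measure.pi fun _ : Fin n => μ)
      ≤ (1 + 45 * (G ^ 2 * (η * T) / n) + 320 * (G ^ 2 * (η * T) / n) ^ 2)
        * ∫ S, oracleRisk φ u W0 (η * T) a r S ∂(Measure.pi fun _ : Fin n => μ) := by
  have hT0 : (0 : ℝ) < T := by exact_mod_cast hT
  set X := κ * (η * T) * Real.sqrt C with hXdef
  have hP : Real.exp (2 / 9 * (η ^ 2 * κ ^ 2 * C) * (T : ℝ) ^ 2
      + η * κ * Real.sqrt (2 * C) * T) ≤ 89 / 10 := by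
    rw [stability_exponent_eq _ _ _ _ hC.le, ← hXdef]
    have h2 := sqrt_two_lt
    have h2' := Real.sqrt_nonneg 2
    have h3 : 2 / 9 * X ^ 2 + Real.sqrt 2 * X ≤ 1 + 1 + 12 / 100 := by nlinarith
    refine (Real.exp_le_exp.2 h3).trans ?_
    rw [Real.exp_add, Real.exp_add]
    have h4 := Real.exp_one_lt_d9
    have h5 : Real.exp (12 / 100) ≤ 1 / (1 - 12 / 100) :=
      Real.exp_bound_div_one_sub_of_interval (by norm_num) (by norm_num)
    have h6 := Real.exp_pos 1
    have h7 : Real.exp 1 * Real.exp 1 ≤ 2.7182818286 * 2.7182818286 :=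
      mul_le_mul h4.le h4.le h6.le (by norm_num)
    calc _ ≤ 2.7182818286 * 2.7182818286 * (1 / (1 - 12 / 100)) :=
          mul_le_mul h7 h5 (Real.exp_pos _).le (by norm_num)
      _ ≤ _ := by norm_num
  have hinit : ∀ S : Fin n → Input d × ℝ, (∀ i, GoodPoint φ u W0 G κ ρ C K (S i)) →
      empRisk φ u S W0 ≤ oracleRisk φ u W0 (η * T) a r S := by
    intro S hS
    have h0 : empRisk φ u S W0 ≤ C := empRisk_le_of_forall hn fun i => (hS i).init_le
    have h1 : 14 / 5 * (2 / 5) * s * C ≤ a * r := le_trans (by gcongr) har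
    rcases le_total s 2 with h2 | h2
    · have h3 := le_oracleRisk (φ := φ) (u := u) (W0 := W0) (S := S) (r := r) ha fun W =>
        avgLoss_mul_le hn (fun i => (hS i).residual) W0 W (show 0 < η * T by positivity)
      refine le_trans ?_ h3
      change empRisk φ u S W0 ≤ empRisk φ u S W0 * (1 - G ^ 2 * (η * T) / 2) + a * r
      rw [← hs2]
      have h4 : s ^ 2 / 2 * empRisk φ u S W0 ≤ s * C := by
        calc _ ≤ s ^ 2 / 2 * C := by gcongr
          _ ≤ s * C := by gcongr; nlinarith
      have h5 : 0 ≤ s * C := by positivity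
      nlinarith
    · have h3 := le_oracleRisk (φ := φ) (u := u) (W0 := W0) (S := S) (τ := η * T) (r := r)
        (b := 0) ha fun W => by
          have := empRisk_nonneg (φ := φ) (u := u) S W
          positivity
      nlinarith
  have hrun : ∀ S : Fin n → Input d × ℝ, (∀ i, GoodPoint φ u W0 G κ ρ C K (S i)) → ∀ t,
      empRisk φ u S (gdIter η (empRisk φ u S) W0 t) ≤ oracleRisk φ u W0 (η * T) a r S :=
    fun S hS t => ((gdRun_of_good hφ hn hκ hη0 hη hS).antitone (Nat.zero_le t)).trans (hinit S hS)
  have h := integral_popRisk_le_of_stable (τ := η * T) (Λ := 1) hφ hφ' hn hκ hη0 hη hgood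
    (by positivity) ha hr hT hP fun S hS => by
      refine ⟨hrun S hS T, ?_⟩
      rw [div_le_iff₀ hT0, one_mul]
      calc _ ≤ ∑ _t ∈ Finset.range T, oracleRisk φ u W0 (η * T) a r S :=
            Finset.sum_le_sum fun t _ => hrun S hS t
        _ = _ := by simp [mul_comm]
  refine h.trans (mul_le_mul_of_nonneg_right ?_
    (integral_nonneg fun S => oracleRisk_nonneg (by positivity) ha hr S))
  have hy : 0 ≤ G ^ 2 * (η * T) / n := by positivity
  nlinarith [sq_nonneg (G ^ 2 * (η * T) / n)]

/-- Large effective curvature: the additive term dominates. -/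
theorem oracle_bound_of_large_curvature (hφ : Differentiable ℝ φ) (hφ' : Continuous (deriv φ))
    (hn : 0 < n) (hκ : 0 ≤ κ) (hη0 : 0 < η) (hη : η * (2 * ρ) ≤ 1) (hC : 0 < C)
    (hgood : ∀ᵐ z ∂μ, GoodPoint φ u W0 G κ ρ C K z) (ha : 0 ≤ a) (hr : 0 ≤ r) (hT : 1 ≤ T)
    {s : ℝ} (hs : 0 ≤ s) (hs2 : s ^ 2 = G ^ 2 * (η * T))
    (har : 14 / 5 * (κ * (η * T) * Real.sqrt C) * s * C ≤ a * r)
    (hX : 5 / 4 ≤ κ * (η * T) * Real.sqrt C) :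
    ∫ S, popRisk φ u μ (gdIter η (empRisk φ u S) W0 T) ∂(Measure.pi fun _ : Fin n => μ)
      ≤ (1 + 320 * (G ^ 2 * (η * T) / n))
        * ∫ S, oracleRisk φ u W0 (η * T) a r S ∂(Measure.pi fun _ : Fin n => μ) := by
  have hT0 : (0 : ℝ) < T := by exact_mod_cast hT
  have hn0 : (0 : ℝ) < n := by exact_mod_cast hn
  have hτ : 0 < η * (T : ℝ) := by positivity
  set X := κ * (η * T) * Real.sqrt C with hXdef
  have hX2 : (κ * (η * T)) ^ 2 * C = X ^ 2 := by
    rw [hXdef, mul_pow (κ * (η * T)), Real.sq_sqrt hC.le]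
  set I := ∫ S, oracleRisk φ u W0 (η * T) a r S ∂(Measure.pi fun _ : Fin n => μ) with hI
  have hI0 : 0 ≤ I := integral_nonneg fun S => oracleRisk_nonneg hτ ha hr S
  have hy : 0 ≤ G ^ 2 * (η * T) / n := by positivity
  have hle : I ≤ (1 + 320 * (G ^ 2 * (η * T) / n)) * I :=
    le_mul_of_one_le_left hI0 (by linarith)
  have hIa : a * r ≤ I := le_integral_oracleRisk hφ hn hgood hτ ha hr
  have hIA : 14 / 5 * X * s * C ≤ I := har.trans hIa
  rcases le_total s (8 / 5 * X) with h1 | h1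
  · refine le_trans ?_ hle
    have h2 := integral_popRisk_le_init hφ hφ' hn hκ hη0 hη hC.le hgood hs hs2
    refine h2.trans ?_
    rcases le_total s 1 with h3 | h3
    · have h4 := le_integral_oracleRisk_init (n := n) hφ hn hgood hτ ha hr
      rw [← hs2, ← hI] at h4
      have h5 : (817 / 500 * s + 2 / 3 * s ^ 2 + s ^ 2 / 2) * C ≤ 14 / 5 * X * s * C := by
        refine mul_le_mul_of_nonneg_right ?_ hC.le
        nlinarith
      linarith
    · have h4 := popRisk_init_le hφ hgood
      have h5 : (1 + (817 / 500 * s + 2 / 3 * s ^ 2)) * C ≤ 14 / 5 * X * s * C := by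
        refine mul_le_mul_of_nonneg_right ?_ hC.le
        nlinarith [mul_nonneg (sub_nonneg.2 h3) (sub_nonneg.2 h1)]
      linarith
  · have hs0 : 0 < s := by linarith
    have h2 := integral_popRisk_le_linearized hφ hφ' hn hκ hη0 hη hC hgood hs0 hs2
    refine h2.trans ?_
    have h3 : (1 + 320 * (G ^ 2 * (η * T) / n)) * (14 / 5 * X * s * C)
        ≤ (1 + 320 * (G ^ 2 * (η * T) / n)) * I := by gcongr
    refine le_trans ?_ h3
    rw [← mul_assoc (1 + 320 * (G ^ 2 * (η * T) / n))]
    refine mul_le_mul_of_nonneg_right ?_ hC.le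
    rw [mul_assoc (4 / 3 : ℝ), hX2, ← hs2]
    have h4 : (80 / 3 * s ^ 2 + 80 / 9 * s ^ 3) / n
        = (80 / 3 + 80 / 9 * s) * (s ^ 2 / n) := by ring
    rw [h4]
    have h5 : 0 ≤ s ^ 2 / (n : ℝ) := by positivity
    have h6 : 5 / 4 * s ≤ X * s := mul_le_mul_of_nonneg_right hX hs
    have h7 : 80 / 3 + 80 / 9 * s ≤ 320 * (14 / 5 * (X * s)) := by linarith
    have h8 := mul_le_mul_of_nonneg_right h7 h5
    have h9 : 4 + 4 / 3 * X ^ 2 + 1 / 10 + s / 20 ≤ 14 / 5 * (X * s) := by nlinarith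
    calc _ ≤ 14 / 5 * (X * s) + 320 * (14 / 5 * (X * s)) * (s ^ 2 / n) := add_le_add h9 h8
      _ = _ := by ring

theorem three_halves_rpow_eq {x : ℝ} (hx : 0 ≤ x) : x ^ ((3 : ℝ) / 2) = x * Real.sqrt x := by
  rw [show (3 : ℝ) / 2 = 1 + 1 / 2 by norm_num, Real.rpow_add' hx (by norm_num), Real.rpow_one,
    Real.sqrt_eq_rpow]

end Oracle

/-- Oracle bound on the statistical risk of gradient descent for shallow networks. The i.i.d.
sample is `S ∼ μ^n`; the infimum over `W` is that of a continuous coercive nonnegative function. -/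
theorem statement19 {d m n : ℕ} (hm1 : 1 ≤ m) (hn : 1 ≤ n)
    (φ : ℝ → ℝ) (Bφ Bφ' Bφ'' : ℝ)
    (hφ : Differentiable ℝ φ) (hφ' : Differentiable ℝ (deriv φ))
    (hBφ : ∀ s : ℝ, |φ s| ≤ Bφ) (hBφ' : ∀ s : ℝ, |deriv φ s| ≤ Bφ')
    (hBφ'' : ∀ s : ℝ, |deriv (deriv φ) s| ≤ Bφ'')
    (u : Fin m → ℝ) (hu : ∀ k, u k = 1 / Real.sqrt m ∨ u k = -(1 / Real.sqrt m))
    (Cx Cy C0 : ℝ) (hCx : 0 < Cx) (hCy : 0 < Cy) (hC0 : 0 < C0)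
    (μ : Measure (Input d × ℝ)) [IsProbabilityMeasure μ]
    (hsupp : ∀ᵐ z ∂μ, ‖z.1‖ ≤ Cx ∧ |z.2| ≤ Cy)
    (W0 : Param d m) (hloss0 : ∀ᵐ z ∂μ, sqLoss φ u W0 z ≤ C0)
    (η : ℝ) (hη0 : 0 < η)
    (hη : η * (2 * smoothConst m Bφ Bφ' Bφ'' Cx Cy) ≤ 1)
    (T : ℕ) (hT : 1 ≤ T)
    (hm : 144 * (η * T) ^ 2 * Cx ^ 4 * C0 ^ 2 * Bφ'' ^ 2
        * (4 * Bφ' * Cx * Real.sqrt (η * T) + Real.sqrt 2) ^ 2 ≤ (m : ℝ)) :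
    (∫ S, popRisk φ u μ (gdIter η (empRisk φ u S) W0 T)
        ∂(Measure.pi fun _ : Fin n => μ))
      ≤ (1 + genConst Bφ' Cx * (η * T / n) * (1 + η * T / n))
          * ∫ S, (⨅ W : Param d m,
                (empRisk φ u S W + ‖W - W0‖ ^ 2 / (η * T)
                  + (2 : ℝ) ^ ((3 : ℝ) / 2) * optConst Bφ' Bφ'' Cx C0 / Real.sqrt m
                      * (‖W - W0‖ ^ 3 + (η * T * C0) ^ ((3 : ℝ) / 2))))
            ∂(Measure.pi fun _ : Fin n => μ) := by
  have hT0 : (0 : ℝ) < T := by exact_mod_cast hT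
  have hn0 : (0 : ℝ) < n := by exact_mod_cast hn
  have hτ : 0 < η * (T : ℝ) := by positivity
  have hB1 : 0 ≤ Bφ' := (abs_nonneg _).trans (hBφ' 0)
  have hB2 : 0 ≤ Bφ'' := (abs_nonneg _).trans (hBφ'' 0)
  set G := Bφ' * Cx with hG
  set κ := Cx ^ 2 * Bφ'' / Real.sqrt m with hκdef
  have hκ : 0 ≤ κ := by positivity
  have hgood : ∀ᵐ z ∂μ, GoodPoint φ u W0 G κ (smoothConst m Bφ Bφ' Bφ'' Cx Cy) C0
      ((Real.sqrt m * Bφ + Cy) ^ 2 / 2) z := by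
    filter_upwards [hsupp, hloss0] with z hz h0
    refine ⟨smoothResidual_nnet hm1 hu hφ hφ' hBφ hBφ' hBφ'' hCx.le hz.1 hz.2, h0, fun W => ?_⟩
    have h : |nnet φ u W z.1 - z.2| ≤ Real.sqrt m * Bφ + Cy :=
      (abs_sub _ _).trans (add_le_add (abs_nnet_le hm1 hu hBφ W z.1) hz.2)
    unfold sqLoss
    gcongr ?_ / 2
    exact sq_le_sq' (abs_le.1 h).1 (abs_le.1 h).2
  set a := (2 : ℝ) ^ ((3 : ℝ) / 2) * optConst Bφ' Bφ'' Cx C0 / Real.sqrt m with ha_def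
  set r := (η * T * C0) ^ ((3 : ℝ) / 2) with hr_def
  have ha_eq : a = 2 * Real.sqrt 2 * (κ * (G + C0)) := by
    rw [ha_def, three_halves_rpow_eq zero_le_two, hκdef, hG]
    unfold optConst
    ring
  have hr_eq : r = η * T * C0 * (Real.sqrt (η * T) * Real.sqrt C0) := by
    rw [hr_def, three_halves_rpow_eq (by positivity), Real.sqrt_mul hτ.le]
  have hG0 : 0 ≤ G := by positivity
  have ha : 0 ≤ a := by rw [ha_eq]; positivity
  have hr : 0 ≤ r := by rw [hr_eq]; positivity
  set s := G * Real.sqrt (η * T) with hs_def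
  have hs : 0 ≤ s := by positivity
  have hs2 : s ^ 2 = G ^ 2 * (η * T) := by rw [hs_def, mul_pow, Real.sq_sqrt hτ.le]
  have h14 : (14 : ℝ) / 10 ≤ Real.sqrt 2 := Real.le_sqrt_of_sq_le (by norm_num)
  have har : 14 / 5 * (κ * (η * T) * Real.sqrt C0) * s * C0 ≤ a * r := by
    have h1 : a * r = 2 * Real.sqrt 2 * ((κ * (η * T) * Real.sqrt C0) * s * C0)
        + 2 * Real.sqrt 2 * (κ * C0 * r) := by
      rw [ha_eq, hr_eq, hs_def]; ring
    have h2 : 0 ≤ (κ * (η * T) * Real.sqrt C0) * s * C0 := by positivity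
    have h3 : 0 ≤ 2 * Real.sqrt 2 * (κ * C0 * r) := by positivity
    rw [h1]
    nlinarith
  change _ ≤ _ * ∫ S, oracleRisk φ u W0 (η * T) a r S ∂(Measure.pi fun _ : Fin n => μ)
  have hI0 : 0 ≤ ∫ S, oracleRisk φ u W0 (η * T) a r S ∂(Measure.pi fun _ : Fin n => μ) :=
    integral_nonneg fun S => oracleRisk_nonneg hτ ha hr S
  set y := G ^ 2 * (η * T) / (n : ℝ) with hy_def
  have hy : 0 ≤ y := by positivity
  have hfac : 1 + 320 * y + 320 * y ^ 2
      ≤ 1 + genConst Bφ' Cx * (η * T / n) * (1 + η * T / n) := by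
    have he : (20 : ℝ) ≤ Real.exp 3 := by
      rw [show (3 : ℝ) = 1 + 1 + 1 by norm_num, Real.exp_add, Real.exp_add]
      have h1 := Real.exp_one_gt_d9
      have h2 : (2.7182818283 : ℝ) * 2.7182818283 ≤ Real.exp 1 * Real.exp 1 :=
        mul_le_mul h1.le h1.le (by norm_num) (Real.exp_pos 1).le
      have h3 : (2.7182818283 : ℝ) * 2.7182818283 * 2.7182818283
          ≤ Real.exp 1 * Real.exp 1 * Real.exp 1 :=
        mul_le_mul h2 h1.le (by norm_num) (by positivity)
      exact le_trans (by norm_num) h3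
    set v := η * T / (n : ℝ) with hv
    have hv0 : 0 ≤ v := by positivity
    have hyv : y = G ^ 2 * v := by rw [hy_def, hv]; ring
    have h1 : genConst Bφ' Cx * v * (1 + v)
        = 16 * Real.exp 3 * (y + y ^ 2 + G ^ 4 * v + G ^ 2 * v ^ 2) := by
      rw [hyv, hG]; unfold genConst; ring
    have h2 : y + y ^ 2 ≤ y + y ^ 2 + G ^ 4 * v + G ^ 2 * v ^ 2 := by
      have : 0 ≤ G ^ 4 * v := by positivity
      have : 0 ≤ G ^ 2 * v ^ 2 := by positivity
      linarith
    have h3 : 320 * (y + y ^ 2)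
        ≤ 16 * Real.exp 3 * (y + y ^ 2 + G ^ 4 * v + G ^ 2 * v ^ 2) :=
      mul_le_mul (by linarith) h2 (by positivity) (by positivity)
    rw [h1]
    linarith
  have hy2 := sq_nonneg y
  rcases le_total (κ * (η * T) * Real.sqrt C0) (2 / 5) with hX | hX
  · refine (oracle_bound_of_small_curvature hφ hφ'.continuous hn hκ hη0 hη hC0 hgood ha hr hT
      hX).trans (mul_le_mul_of_nonneg_right (le_trans ?_ hfac) hI0)
    linarith
  rcases le_total (κ * (η * T) * Real.sqrt C0) (5 / 4) with hX' | hX'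
  · refine (oracle_bound_of_moderate_curvature hφ hφ'.continuous hn hκ hη0 hη hC0 hgood ha hr hT
      hs hs2 har hX hX').trans (mul_le_mul_of_nonneg_right (le_trans ?_ hfac) hI0)
    linarith
  · refine (oracle_bound_of_large_curvature hφ hφ'.continuous hn hκ hη0 hη hC0 hgood ha hr hT
      hs hs2 har hX').trans (mul_le_mul_of_nonneg_right (le_trans ?_ hfac) hI0)
    linarith
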